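/- arXiv:2008.10500 — 2 statements merged into one kernel-verified Lean document; each statement's English description precedes it below -/
import Mathlib

section
/- Let α > 1 be an irrational real number. Then as n → ∞, q_α(n) ~ exp(π·√(n/(3α))) / (2^{2 − 1/(2α)} · (3α)^{1/4} · n^{3/4}), i.e. the ratio of q_α(n) to this expression tends to 1. -/
open Filter Topology Real

/-- The number of partitions of `n` into distinct parts, all chosen from the Beatty
sequence `(⌊α m⌋)_{m ≥ 1}`. -/
noncomputable def beattyDistinctPartitions (α : ℝ) (n : ℕ) : ℕ :=
  Nat.card {P : n.Partition //
    P.parts.Nodup ∧ ∀ j ∈ P.parts, ∃ m : ℕ, 0 < m ∧ (j : ℤ) = ⌊α * m⌋}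

/-- Beatty sequence -/
noncomputable def bt (α : ℝ) (m : ℕ) : ℕ := ⌊α * m⌋₊

lemma bt_le {α : ℝ} (hα : 1 < α) (m : ℕ) : (bt α m : ℝ) ≤ α * m :=
  Nat.floor_le (by positivity)

lemma bt_gt {α : ℝ} (m : ℕ) : α * m - 1 < (bt α m : ℝ) := by
  have := Nat.lt_floor_add_one (α * m)
  unfold bt; linarith

lemma le_bt {α : ℝ} (hα : 1 < α) (m : ℕ) : m ≤ bt α m := by
  apply Nat.le_floor
  nlinarith [(Nat.cast_nonneg m : (0:ℝ) ≤ m)]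

lemma bt_strictMono {α : ℝ} (hα : 1 < α) : StrictMono (bt α) := by
  apply strictMono_nat_of_lt_succ
  intro m
  have h1 := bt_le hα m
  have h2 := bt_gt (α := α) (m+1)
  push_cast at h2
  have : (bt α m : ℝ) < bt α (m+1) := by nlinarith
  exact_mod_cast this

lemma bt_int {α : ℝ} (hα : 1 < α) (m : ℕ) : ((bt α m : ℕ) : ℤ) = ⌊α * m⌋ := by
  unfold bt
  exact Int.natCast_floor_eq_floor (by positivity)

lemma card_eq {α : ℝ} (hα : 1 < α) (n : ℕ) :
    beattyDistinctPartitions α n =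
      ((Finset.Icc 1 n).powerset.filter (fun S => ∑ m ∈ S, bt α m = n)).card := by
  classical
  have hinj := (bt_strictMono hα).injective
  unfold beattyDistinctPartitions
  set F := (Finset.Icc 1 n).powerset.filter (fun S => ∑ m ∈ S, bt α m = n) with hF
  rw [← Nat.card_eq_finsetCard F]
  symm
  have hmem : ∀ S : Finset ℕ, S ∈ F → S ⊆ Finset.Icc 1 n ∧ ∑ m ∈ S, bt α m = n := by
    intro S hS
    simpa [hF] using hS
  let g : F → {P : n.Partition //
    P.parts.Nodup ∧ ∀ j ∈ P.parts, ∃ m : ℕ, 0 < m ∧ (j : ℤ) = ⌊α * m⌋} := fun S =>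
    ⟨⟨S.1.val.map (bt α), by
        intro i hi
        obtain ⟨m, hm, rfl⟩ := Multiset.mem_map.1 hi
        have := Finset.mem_Icc.1 ((hmem S.1 S.2).1 hm)
        exact lt_of_lt_of_le this.1 (le_bt hα m), (hmem S.1 S.2).2⟩,
      Multiset.Nodup.map hinj S.1.nodup, by
        intro i hi
        obtain ⟨m, hm, rfl⟩ := Multiset.mem_map.1 hi
        have := Finset.mem_Icc.1 ((hmem S.1 S.2).1 hm)
        exact ⟨m, this.1, bt_int hα m⟩⟩
  apply Nat.card_eq_of_bijective g
  constructor
  · intro S T h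
    have h1 : S.1.val.map (bt α) = T.1.val.map (bt α) :=
      congrArg (fun P => P.1.parts) h
    exact Subtype.ext (Finset.val_injective (Multiset.map_injective hinj h1))
  · rintro ⟨P, hnd, hP⟩
    have key : ((Finset.Icc 1 n).filter (fun m => bt α m ∈ P.parts)).val.map (bt α) = P.parts := by
      refine (Multiset.Nodup.ext (Multiset.Nodup.map hinj (Finset.nodup _)) hnd).2 ?_
      intro j
      rw [Multiset.mem_map]
      constructor
      · rintro ⟨m, hm, rfl⟩
        rw [Finset.mem_val, Finset.mem_filter] at hm
        exact hm.2
      · intro hj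
        obtain ⟨m, hm, hjm⟩ := hP j hj
        have hjb : j = bt α m := by
          have := bt_int hα m
          rw [← hjm] at this
          exact_mod_cast this.symm
        refine ⟨m, ?_, hjb.symm⟩
        rw [Finset.mem_val, Finset.mem_filter]
        refine ⟨Finset.mem_Icc.2 ⟨hm, ?_⟩, hjb ▸ hj⟩
        have h1 : j ≤ n := by
          have := Multiset.le_sum_of_mem hj
          rwa [P.parts_sum] at this
        exact (le_bt hα m).trans (hjb ▸ h1)
    refine ⟨⟨(Finset.Icc 1 n).filter (fun m => bt α m ∈ P.parts), ?_⟩, ?_⟩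
    · rw [hF, Finset.mem_filter, Finset.mem_powerset]
      refine ⟨Finset.filter_subset _ _, ?_⟩
      have := congrArg Multiset.sum key
      rw [P.parts_sum] at this
      exact this
    · apply Subtype.ext
      apply Nat.Partition.ext
      exact key

/-- Fourier integral representation -/
lemma fourier_rep {α : ℝ} (hα : 1 < α) (n : ℕ) (t : ℝ) :
    ∫ θ in (-π)..π, Complex.exp (-(Complex.I * θ * n)) *
      ∏ m ∈ Finset.Icc 1 n, (1 + Complex.exp ((-t + Complex.I * θ) * bt α m)) =
    2 * π * (beattyDistinctPartitions α n : ℂ) * Complex.exp (-(t * n)) := by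
  have h1 : ∀ θ : ℝ, Complex.exp (-(Complex.I * θ * n)) *
      ∏ m ∈ Finset.Icc 1 n, (1 + Complex.exp ((-t + Complex.I * θ) * bt α m)) =
      ∑ S ∈ (Finset.Icc 1 n).powerset, Complex.exp (-(t * (∑ m ∈ S, bt α m : ℕ))) *
        Complex.exp (Complex.I * ((∑ m ∈ S, bt α m : ℕ) - n : ℂ) * θ) := by
    intro θ
    rw [Finset.prod_one_add, Finset.mul_sum]
    refine Finset.sum_congr rfl fun S _ => ?_
    rw [← Complex.exp_sum, ← Complex.exp_add, ← Complex.exp_add, ← Finset.mul_sum]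
    congr 1
    push_cast
    ring
  simp_rw [h1]
  rw [intervalIntegral.integral_finsetSum (fun S _ => by
    apply Continuous.intervalIntegrable; fun_prop)]
  have h2 : ∀ k : ℕ, ∫ θ in (-π)..π, Complex.exp (-(t * (k : ℂ))) *
      Complex.exp (Complex.I * ((k : ℂ) - n) * (θ : ℂ)) =
      if k = n then 2 * π * Complex.exp (-(t * n)) else 0 := by
    intro k
    rw [intervalIntegral.integral_const_mul]
    split_ifs with h
    · subst h
      simp
      ring
    · have hk : (k : ℂ) - n ≠ 0 := sub_ne_zero.2 (by exact_mod_cast h)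
      rw [integral_exp_mul_complex (mul_ne_zero Complex.I_ne_zero hk)]
      have : Complex.exp (Complex.I * ((k : ℂ) - n) * (π : ℝ)) =
          Complex.exp (Complex.I * ((k : ℂ) - n) * ((-π : ℝ))) := by
        rw [Complex.exp_eq_exp_iff_exists_int]
        refine ⟨(k : ℤ) - n, ?_⟩
        push_cast
        ring
      rw [this]
      simp
  rw [Finset.sum_congr rfl (fun S _ => h2 _), ← Finset.sum_filter, Finset.sum_const, card_eq hα n]
  simp only [nsmul_eq_mul]
  ring

lemma sin_sq_sub_le (x y : ℝ) : sin (x - y) ^ 2 ≤ 2 * (sin x ^ 2 + sin y ^ 2) := by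
  rw [sin_sub]
  have h1 := sin_sq_add_cos_sq x
  have h2 := sin_sq_add_cos_sq y
  have h3 : (sin x * cos y) ^ 2 ≤ sin x ^ 2 := by
    rw [mul_pow]; nlinarith [sq_nonneg (sin x), sq_nonneg (sin y)]
  have h4 : (cos x * sin y) ^ 2 ≤ sin y ^ 2 := by
    rw [mul_pow]; nlinarith [sq_nonneg (sin x), sq_nonneg (sin y)]
  nlinarith [sq_nonneg (sin x * cos y + cos x * sin y)]

lemma sin_sq_ge {x : ℝ} (hx : |x| ≤ π / 2) : (2 / π * x) ^ 2 ≤ sin x ^ 2 := by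
  have h := Real.mul_le_sin (abs_nonneg x) hx
  have h0 : 0 ≤ 2 / π * |x| := by positivity
  have h1 : (2 / π * |x|) ^ 2 ≤ sin |x| ^ 2 := by gcongr
  rcases abs_cases x with ⟨h2, _⟩ | ⟨h2, _⟩ <;> rw [h2] at h1
  · exact h1
  · rw [sin_neg] at h1; nlinarith

lemma sin_sq_ge' {x : ℝ} (hx : |x| ≤ π / 2) : x ^ 2 * (2 / 5) ≤ sin x ^ 2 := by
  refine le_trans ?_ (sin_sq_ge hx)
  rw [mul_pow, mul_comm]
  gcongr
  rw [div_pow, div_le_div_iff₀ (by norm_num) (by positivity)]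
  nlinarith [Real.pi_lt_d2, Real.pi_pos]

lemma step_bound (s : ℕ → ℝ) (M L : ℕ) (hL : L ≤ M) (f : ℕ → ℝ)
    (h : ∀ m, f m ≤ 2 * (s (m + L) + s m)) (hs : ∀ m, 0 ≤ s m) :
    ∑ m ∈ Finset.Icc 1 (M - L), f m ≤ 4 * ∑ m ∈ Finset.Icc 1 M, s m := by
  have h1 : ∑ m ∈ Finset.Icc 1 (M - L), s m ≤ ∑ m ∈ Finset.Icc 1 M, s m := by
    apply Finset.sum_le_sum_of_subset_of_nonneg
    · intro m; simp only [Finset.mem_Icc]; omega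
    · intro i _ _; exact hs i
  have h2 : ∑ m ∈ Finset.Icc 1 (M - L), s (m + L) ≤ ∑ m ∈ Finset.Icc 1 M, s m := by
    rw [← Finset.sum_image (f := s) (g := fun m => m + L) (by intro a _ b _ h; simpa using h)]
    apply Finset.sum_le_sum_of_subset_of_nonneg
    · intro m; simp only [Finset.mem_Icc, Finset.mem_image]; rintro ⟨a, ha, rfl⟩; omega
    · intro i _ _; exact hs i
  calc _ ≤ ∑ m ∈ Finset.Icc 1 (M - L), 2 * (s (m + L) + s m) := Finset.sum_le_sum fun m _ => h m
    _ = 2 * (∑ m ∈ Finset.Icc 1 (M - L), s (m + L) + ∑ m ∈ Finset.Icc 1 (M - L), s m) := by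
      rw [← Finset.mul_sum, Finset.sum_add_distrib]
    _ ≤ _ := by linarith

lemma sum_sq_ge (M : ℕ) : (M : ℝ) ^ 3 / 3 ≤ ∑ m ∈ Finset.Icc 1 M, (m : ℝ) ^ 2 := by
  induction M with
  | zero => simp
  | succ k ih =>
    rw [Finset.sum_Icc_succ_top (by omega)]
    push_cast
    nlinarith [(Nat.cast_nonneg k : (0:ℝ) ≤ k)]

/-- sum of the sine squares -/
noncomputable def sinS (α θ : ℝ) (M : ℕ) : ℝ :=
  ∑ m ∈ Finset.Icc 1 M, sin (θ * bt α m / 2) ^ 2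

lemma sinS_small {α : ℝ} (hα : 1 < α) {θ : ℝ} {M : ℕ} (h : |θ| * (α * M) ≤ 3) :
    θ ^ 2 * (M : ℝ) ^ 3 / 30 ≤ sinS α θ M := by
  have h1 : ∀ m ∈ Finset.Icc 1 M, θ ^ 2 / 10 * (m : ℝ) ^ 2 ≤ sin (θ * bt α m / 2) ^ 2 := by
    intro m hm
    have hm' := (Finset.mem_Icc.1 hm).2
    have hb : (bt α m : ℝ) ≤ α * M := (bt_le hα m).trans (by gcongr)
    have hb2 : (m : ℝ) ≤ bt α m := by exact_mod_cast le_bt hα m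
    have h2 : |θ * bt α m / 2| ≤ π / 2 := by
      rw [abs_div, abs_mul, Nat.abs_cast, abs_two]
      have : |θ| * bt α m ≤ |θ| * (α * M) := by gcongr
      linarith [Real.pi_gt_three]
    refine le_trans ?_ (sin_sq_ge' h2)
    have : (m : ℝ) ^ 2 ≤ (bt α m : ℝ) ^ 2 := by gcongr
    nlinarith [sq_nonneg θ]
  have h2 := Finset.sum_le_sum h1
  rw [← Finset.mul_sum] at h2
  have h3 := sum_sq_ge M
  unfold sinS
  nlinarith [sq_nonneg θ]

lemma sinS_mid {α : ℝ} (hα : 1 < α) {θ : ℝ} {M : ℕ} (h0 : 0 < θ) (h : 3 ≤ θ * (α * M))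
    (h2 : θ * (2 * (α + 1)) ≤ 1) :
    (M : ℝ) / 80 ≤ sinS α θ M := by
  set L : ℕ := ⌊(3 / 2) / (α * θ)⌋₊ with hL
  have hαθ : 0 < α * θ := by positivity
  have hL1 : (L : ℝ) * (α * θ) ≤ 3 / 2 := by
    rw [← le_div_iff₀ hαθ]; exact Nat.floor_le (by positivity)
  have hL2 : 3 / 2 < ((L : ℝ) + 1) * (α * θ) := by
    rw [← div_lt_iff₀ hαθ]; exact Nat.lt_floor_add_one _
  have hLM : (L : ℝ) ≤ M / 2 := by
    by_contra hc
    push Not at hc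
    nlinarith
  have hLM' : L ≤ M := by
    have : (L : ℝ) ≤ M := by linarith [(Nat.cast_nonneg M : (0:ℝ) ≤ M)]
    exact_mod_cast this
  have key := step_bound (fun m => sin (θ * bt α m / 2) ^ 2) M L hLM' (fun _ => 1 / 10) (by
    intro m
    refine le_trans ?_ (sin_sq_sub_le _ _)
    have e1 := bt_le hα m
    have e2 := bt_gt (α := α) m
    have e3 := bt_le hα (m + L)
    have e4 := bt_gt (α := α) (m + L)
    push_cast at e3 e4
    have x1 : 1 / 2 ≤ θ * bt α (m + L) / 2 - θ * bt α m / 2 := by nlinarith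
    have x2 : θ * bt α (m + L) / 2 - θ * bt α m / 2 ≤ 1 := by nlinarith
    refine le_trans ?_ (sin_sq_ge' (by rw [abs_of_nonneg (by linarith)]; linarith [Real.pi_gt_three]))
    nlinarith) (fun m => sq_nonneg _)
  simp only [Finset.sum_const, Nat.card_Icc, nsmul_eq_mul] at key
  rw [Nat.add_sub_cancel, Nat.cast_sub hLM'] at key
  unfold sinS
  linarith

lemma sinS_large {α : ℝ} (hα : 1 < α) (hirr : Irrational α) : ∃ c > 0, ∃ M0 : ℕ, ∀ M ≥ M0,
    ∀ θ : ℝ, |θ| ≤ π → c * θ ^ 2 * M ≤ sinS α θ M := by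
  set a : ℕ := ⌊α⌋₊ with ha
  have ha1 : (a : ℝ) < α := by
    refine lt_of_le_of_ne (Nat.floor_le (by linarith)) ?_
    intro h
    exact hirr.ne_nat a h.symm
  have ha2 : α < a + 1 := Nat.lt_floor_add_one _
  obtain ⟨κ, hκ, hκ1, hκ2⟩ : ∃ κ : ℝ, 0 < κ ∧ κ ≤ α - a ∧ κ ≤ a + 1 - α :=
    ⟨min (α - a) (a + 1 - α), lt_min (by linarith) (by linarith), min_le_left _ _, min_le_right _ _⟩
  obtain ⟨M0, hM0⟩ := exists_nat_ge (2 * (1 + κ) / κ + 1)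
  refine ⟨κ / 160, by positivity, M0, ?_⟩
  intro M hM θ hθ
  have hM' : 2 * (1 + κ) / κ + 1 ≤ M := hM0.trans (by exact_mod_cast hM)
  have hM1 : (1 : ℝ) ≤ M := by
    have : 0 ≤ 2 * (1 + κ) / κ := by positivity
    linarith
  have hM1' : 1 ≤ M := by exact_mod_cast hM1
  have hM2 : 2 * (1 + κ) ≤ κ * M := by
    have : 2 * (1 + κ) / κ ≤ M := by linarith
    rw [div_le_iff₀ hκ] at this
    linarith
  set sa := sin (θ * a / 2) ^ 2 with hsa
  set sb := sin (θ * (a + 1) / 2) ^ 2 with hsb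
  have hd : ∀ m : ℕ, bt α (m + 1) = bt α m + a ∨ bt α (m + 1) = bt α m + a + 1 := by
    intro m
    have e1 := bt_le hα m
    have e2 := bt_gt (α := α) m
    have e3 := bt_le hα (m + 1)
    have e4 := bt_gt (α := α) (m + 1)
    push_cast at e3 e4
    have f1 : (bt α m : ℝ) + a < bt α (m + 1) + 1 := by linarith
    have f2 : (bt α (m + 1) : ℝ) < bt α m + a + 2 := by linarith
    have f1' : bt α m + a < bt α (m + 1) + 1 := by exact_mod_cast f1
    have f2' : bt α (m + 1) < bt α m + a + 2 := by exact_mod_cast f2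
    omega
  have key := step_bound (fun m => sin (θ * bt α m / 2) ^ 2) M 1 hM1'
    (fun m => ((a : ℝ) + 1 - (bt α (m + 1) - bt α m)) * sa + ((bt α (m + 1) : ℝ) - bt α m - a) * sb)
    (by
      intro m
      refine le_trans (le_of_eq ?_) (sin_sq_sub_le _ _)
      rcases hd m with h | h
      · rw [h, hsa]
        push_cast
        rw [show θ * ((bt α m : ℝ) + a) / 2 - θ * bt α m / 2 = θ * a / 2 by ring]
        ring
      · rw [h, hsb]
        push_cast
        rw [show θ * ((bt α m : ℝ) + a + 1) / 2 - θ * bt α m / 2 = θ * (a + 1) / 2 by ring]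
        ring) (fun m => sq_nonneg _)
  have tel : ∀ K : ℕ, ∑ m ∈ Finset.Icc 1 K, (((a : ℝ) + 1 - (bt α (m + 1) - bt α m)) * sa +
      ((bt α (m + 1) : ℝ) - bt α m - a) * sb) =
      (((a : ℝ) + 1) * K - (bt α (K + 1) - bt α 1)) * sa +
        ((bt α (K + 1) : ℝ) - bt α 1 - a * K) * sb := by
    intro K
    induction K with
    | zero => simp
    | succ k ih =>
      rw [Finset.sum_Icc_succ_top (by omega), ih]
      push_cast
      ring
  rw [tel] at key
  obtain ⟨K, rfl⟩ : ∃ K, M = K + 1 := ⟨M - 1, by omega⟩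
  simp only [Nat.add_sub_cancel] at key
  have e1 := bt_le hα 1
  have e2 := bt_gt (α := α) 1
  have e3 := bt_le hα (K + 1)
  have e4 := bt_gt (α := α) (K + 1)
  push_cast at e1 e2 e3 e4 hM2 ⊢
  have c1 : κ * ((K : ℝ) + 1) / 2 ≤ ((a : ℝ) + 1) * K - (bt α (K + 1) - bt α 1) := by nlinarith
  have c2 : κ * ((K : ℝ) + 1) / 2 ≤ (bt α (K + 1) : ℝ) - bt α 1 - a * K := by nlinarith
  have hsab : θ ^ 2 / 20 ≤ sa + sb := by
    have h1 := sin_sq_sub_le (θ * (a + 1) / 2) (θ * a / 2)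
    rw [show θ * ((a : ℝ) + 1) / 2 - θ * a / 2 = θ / 2 by ring] at h1
    have h2 := sin_sq_ge' (x := θ / 2) (by rw [abs_div, abs_two]; linarith)
    have : (θ / 2) ^ 2 = θ ^ 2 / 4 := by ring
    linarith
  have hsa0 : 0 ≤ sa := sq_nonneg _
  have hsb0 : 0 ≤ sb := sq_nonneg _
  have q1 := mul_le_mul_of_nonneg_right c1 hsa0
  have q2 := mul_le_mul_of_nonneg_right c2 hsb0
  have q3 : κ * ((K : ℝ) + 1) / 2 * (θ ^ 2 / 20) ≤ κ * ((K : ℝ) + 1) / 2 * (sa + sb) := by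
    gcongr
  unfold sinS
  nlinarith

lemma sinS_neg (α θ : ℝ) (M : ℕ) : sinS α (-θ) M = sinS α θ M := by
  unfold sinS
  refine Finset.sum_congr rfl fun m _ => ?_
  rw [show -θ * (bt α m : ℝ) / 2 = -(θ * bt α m / 2) by ring, sin_neg, neg_sq]

lemma sinS_main {α : ℝ} (hα : 1 < α) (hirr : Irrational α) : ∃ c > 0, ∃ M0 : ℕ, ∀ M ≥ M0,
    ∀ θ : ℝ, |θ| ≤ π → c * min (M : ℝ) (θ ^ 2 * M ^ 3) ≤ sinS α θ M := by
  obtain ⟨c, hc, M0, h⟩ := sinS_large hα hirr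
  set δ : ℝ := 1 / (2 * (α + 1)) with hδ
  have hδ0 : 0 < δ := by positivity
  refine ⟨min (1 / 80) (c * δ ^ 2), by positivity, M0, ?_⟩
  have main : ∀ M ≥ M0, ∀ θ : ℝ, 0 ≤ θ → θ ≤ π →
      min (1 / 80) (c * δ ^ 2) * min (M : ℝ) (θ ^ 2 * M ^ 3) ≤ sinS α θ M := by
    intro M hM θ h0 hπ
    have hM0 : (0 : ℝ) ≤ M := Nat.cast_nonneg _
    by_cases c1 : θ * (α * M) ≤ 3
    · have := sinS_small hα (θ := θ) (M := M) (by rwa [abs_of_nonneg h0])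
      have e : min (1 / 80) (c * δ ^ 2) * min (M : ℝ) (θ ^ 2 * M ^ 3) ≤
          (1 / 80) * (θ ^ 2 * M ^ 3) := by
        gcongr
        · exact min_le_left _ _
        · exact min_le_right _ _
      have : 0 ≤ θ ^ 2 * (M : ℝ) ^ 3 := by positivity
      linarith
    · push Not at c1
      have hθ : 0 < θ := by
        rcases h0.eq_or_lt with h | h
        · rw [← h] at c1; simp at c1; linarith
        · exact h
      by_cases c2 : θ * (2 * (α + 1)) ≤ 1
      · have := sinS_mid hα hθ c1.le c2
        have e : min (1 / 80) (c * δ ^ 2) * min (M : ℝ) (θ ^ 2 * M ^ 3) ≤ (1 / 80) * M := by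
          gcongr
          · exact min_le_left _ _
          · exact min_le_left _ _
        linarith
      · push Not at c2
        have hd : δ ≤ θ := by
          rw [hδ, div_le_iff₀ (by positivity)]; exact c2.le
        have := h M hM θ (by rwa [abs_of_nonneg h0])
        have e : min (1 / 80) (c * δ ^ 2) * min (M : ℝ) (θ ^ 2 * M ^ 3) ≤ (c * θ ^ 2) * M := by
          gcongr
          · exact (min_le_right _ _).trans (by gcongr)
          · exact min_le_left _ _
        linarith
  intro M hM θ hθ
  rcases le_total 0 θ with h0 | h0
  · exact main M hM θ h0 (by rwa [abs_of_nonneg h0] at hθ)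
  · have := main M hM (-θ) (by linarith) (by rwa [abs_of_nonpos h0] at hθ)
    rwa [neg_sq, sinS_neg] at this

lemma sum_mod (r p : ℤ) (q : ℕ) (hq : 0 < q) (hpq : IsCoprime p (q : ℤ)) :
    ∑ j ∈ Finset.range q, (((r + j * p) % q : ℤ) : ℝ) = q * (q - 1) / 2 := by
  have hq' : (0 : ℤ) < q := by exact_mod_cast hq
  set g : ℕ → ℕ := fun j => ((r + j * p) % q).toNat with hg
  have hgc : ∀ j, ((g j : ℕ) : ℤ) = (r + j * p) % q := fun j =>
    Int.toNat_of_nonneg (Int.emod_nonneg _ hq'.ne')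
  have hinj : Set.InjOn g (Finset.range q : Set ℕ) := by
    intro i hi j hj h
    have h1 : (r + i * p) % q = (r + j * p) % q := by rw [← hgc, ← hgc, h]
    have h2 : (q : ℤ) ∣ (i - j) * p := by
      have := Int.emod_emod_of_dvd
      have h3 := (Int.emod_eq_emod_iff_emod_sub_eq_zero).1 h1
      have h4 := Int.dvd_of_emod_eq_zero h3
      convert h4 using 1; ring
    have h5 : (q : ℤ) ∣ (i - j) := hpq.symm.dvd_of_dvd_mul_right h2
    have hi' := Finset.mem_range.1 (Finset.mem_coe.1 hi)
    have hj' := Finset.mem_range.1 (Finset.mem_coe.1 hj)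
    have h6 : ((i : ℤ) - j) = 0 := by
      apply Int.eq_zero_of_abs_lt_dvd h5
      rw [abs_lt]; constructor <;> omega
    omega
  have himg : (Finset.range q).image g = Finset.range q := by
    apply Finset.eq_of_subset_of_card_le
    · intro x hx
      obtain ⟨j, _, rfl⟩ := Finset.mem_image.1 hx
      rw [Finset.mem_range]
      have := Int.emod_lt_of_pos (r + j * p) hq'
      rw [← hgc] at this
      exact_mod_cast this
    · rw [Finset.card_image_of_injOn hinj]
  have h1 : ∀ j : ℕ, (((r + j * p) % q : ℤ) : ℝ) = ((g j : ℕ) : ℝ) := by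
    intro j; rw [← hgc]; simp
  simp_rw [h1]
  rw [← Finset.sum_image (f := fun x : ℕ => (x : ℝ)) hinj, himg]
  have := Finset.sum_range_id_mul_two q
  have h2 : ((∑ i ∈ Finset.range q, i : ℕ) : ℝ) * 2 = q * (q - 1) := by
    have h3 : (((∑ i ∈ Finset.range q, i) * 2 : ℕ) : ℝ) = ((q * (q - 1) : ℕ) : ℝ) := by rw [this]
    push_cast [Nat.cast_sub hq] at h3 ⊢
    exact h3
  push_cast at h2
  linarith

lemma sum_fract (y : ℝ) (p : ℤ) (q : ℕ) (hq : 0 < q) (hpq : IsCoprime p (q : ℤ)) :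
    |∑ j ∈ Finset.range q, Int.fract (y + j * (p / q)) - q / 2| ≤ 1 / 2 := by
  have hq' : (0 : ℤ) < q := by exact_mod_cast hq
  have hqr : (0 : ℝ) < q := by exact_mod_cast hq
  set r := ⌊q * y⌋ with hr
  set e := Int.fract (q * y) with he
  have he0 := Int.fract_nonneg (q * y)
  have he1 := Int.fract_lt_one (q * y)
  have hre : (r : ℝ) + e = q * y := Int.floor_add_fract _
  have h1 : ∀ j : ℕ, Int.fract (y + j * ((p : ℝ) / q)) =
      ((((r + j * p) % q : ℤ) : ℝ) + e) / q := by
    intro j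
    rw [Int.fract_eq_iff]
    have a0 := Int.emod_nonneg (r + j * p) hq'.ne'
    have a1 := Int.emod_lt_of_pos (r + j * p) hq'
    have a1' : (r + j * p) % q + 1 ≤ q := a1
    have a0r : (0 : ℝ) ≤ (((r + j * p) % q : ℤ) : ℝ) := by exact_mod_cast a0
    have a1r : (((r + j * p) % q : ℤ) : ℝ) + 1 ≤ q := by exact_mod_cast a1'
    refine ⟨by positivity, by rw [div_lt_one hqr]; linarith, (r + j * p) / q, ?_⟩
    have a2 := Int.mul_ediv_add_emod (r + j * p) q
    have a2r : (q : ℝ) * (((r + j * p) / q : ℤ) : ℝ) + (((r + j * p) % q : ℤ) : ℝ) = r + j * p := by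
      exact_mod_cast a2
    have hy : y = (r + e) / q := by rw [hre]; field_simp
    rw [hy]
    field_simp
    linarith
  simp_rw [h1]
  rw [← Finset.sum_div, Finset.sum_add_distrib, sum_mod r p q hq hpq]
  simp only [Finset.sum_const, Finset.card_range, nsmul_eq_mul]
  have : ((q : ℝ) * (q - 1) / 2 + q * e) / q - q / 2 = e - 1 / 2 := by field_simp; ring
  rw [this, abs_le]
  constructor <;> linarith

lemma block {α : ℝ} (p : ℤ) (q : ℕ) (hq : 0 < q) (hpq : IsCoprime p (q : ℤ))
    (h : |α - p / q| ≤ 1 / (q : ℝ) ^ 2) (k : ℕ) :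
    |∑ j ∈ Finset.range q, (Int.fract (α * ((k + j : ℕ) : ℝ)) - 1 / 2)| ≤ 3 := by
  have hqr : (0 : ℝ) < q := by exact_mod_cast hq
  set ε := α - p / q with hε
  have hα : α = p / q + ε := by rw [hε]; ring
  have s1 := sum_fract (α * k - 1 / q) p q hq hpq
  have s2 := sum_fract (α * k + 1 / q) p q hq hpq
  have hj : ∀ j ∈ Finset.range q, |(j : ℝ) * ε| ≤ 1 / q := by
    intro j hj
    have hjq : (j : ℝ) ≤ q := by exact_mod_cast (Finset.mem_range.1 hj).le
    rw [abs_mul, Nat.abs_cast]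
    calc (j : ℝ) * |ε| ≤ q * (1 / (q : ℝ) ^ 2) := by gcongr
      _ = 1 / q := by field_simp
  have hfl : ∀ x y : ℝ, x ≤ y → Int.fract y ≤ Int.fract x + (y - x) := by
    intro x y hxy
    have : (⌊x⌋ : ℝ) ≤ ⌊y⌋ := by exact_mod_cast Int.floor_mono hxy
    unfold Int.fract
    linarith
  have u1 : ∑ j ∈ Finset.range q, Int.fract (α * ((k + j : ℕ) : ℝ)) ≤
      ∑ j ∈ Finset.range q, (Int.fract (α * k - 1 / q + j * (p / q)) + 2 / q) := by
    refine Finset.sum_le_sum fun j hjm => ?_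
    have := abs_le.1 (hj j hjm)
    have e : α * ((k + j : ℕ) : ℝ) = α * k + j * (p / q) + j * ε := by
      push_cast; rw [mul_add, mul_comm α (j : ℝ)]; nth_rewrite 2 [hα]; ring
    refine (hfl (α * k - 1 / q + j * (p / q)) _ (by rw [e]; linarith)).trans ?_
    rw [e]
    have : (2 : ℝ) / q = 1 / q + 1 / q := by ring
    linarith
  have u2 : ∑ j ∈ Finset.range q, (Int.fract (α * k + 1 / q + j * (p / q)) - 2 / q) ≤
      ∑ j ∈ Finset.range q, Int.fract (α * ((k + j : ℕ) : ℝ)) := by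
    refine Finset.sum_le_sum fun j hjm => ?_
    have := abs_le.1 (hj j hjm)
    have e : α * ((k + j : ℕ) : ℝ) = α * k + j * (p / q) + j * ε := by
      push_cast; rw [mul_add, mul_comm α (j : ℝ)]; nth_rewrite 2 [hα]; ring
    have h3 := hfl (α * ((k + j : ℕ) : ℝ)) (α * k + 1 / q + j * (p / q)) (by rw [e]; linarith)
    rw [e] at h3 ⊢
    have : (2 : ℝ) / q = 1 / q + 1 / q := by ring
    linarith
  rw [Finset.sum_add_distrib] at u1
  rw [Finset.sum_sub_distrib] at u2
  rw [Finset.sum_sub_distrib]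
  simp only [Finset.sum_const, Finset.card_range, nsmul_eq_mul] at u1 u2 ⊢
  have : (q : ℝ) * (2 / q) = 2 := by field_simp
  rw [this] at u1 u2
  rw [abs_le] at s1 s2 ⊢
  constructor <;> linarith

lemma exists_good {α : ℝ} (hirr : Irrational α) (K : ℕ) : ∃ (p : ℤ) (q : ℕ), K < q ∧
    IsCoprime p (q : ℤ) ∧ |α - p / q| ≤ 1 / (q : ℝ) ^ 2 := by
  have h1 := hirr.eventually_forall_le_dist_cast_rat_of_den_le K
  obtain ⟨δ, hδ, h2⟩ := Metric.eventually_nhds_iff.1 h1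
  obtain ⟨n, hn⟩ := exists_nat_gt (2 / δ)
  have hn0 : (0 : ℝ) < n := lt_trans (by positivity) hn
  obtain ⟨x, hx1, hx2⟩ := exists_rat_abs_sub_le_and_den_le α (n := n) (by exact_mod_cast hn0)
  have hd : (0 : ℝ) < x.den := by exact_mod_cast x.den_pos
  have hd1 : (1 : ℝ) ≤ x.den := by exact_mod_cast x.den_pos
  refine ⟨x.num, x.den, ?_, ?_, ?_⟩
  · by_contra hc
    push Not at hc
    have h3 := h2 (y := δ / 2) (by rw [Real.dist_eq, sub_zero, abs_of_pos (by positivity)]; linarith) x hc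
    rw [Real.dist_eq] at h3
    have h4 : 1 / (((n : ℝ) + 1) * x.den) < δ / 2 := by
      rw [div_lt_iff₀ hδ] at hn
      rw [div_lt_iff₀ (by positivity)]
      nlinarith
    linarith
  · rw [Int.isCoprime_iff_gcd_eq_one]
    exact x.reduced
  · rw [show ((x.num : ℝ) / x.den) = (x : ℝ) by rw [Rat.cast_def]]
    refine hx1.trans ?_
    rw [sq]
    gcongr
    have : (x.den : ℝ) ≤ n := by exact_mod_cast hx2
    linarith

lemma equidist {α : ℝ} (hirr : Irrational α) {η : ℝ} (hη : 0 < η) : ∃ C : ℝ, 0 ≤ C ∧ ∀ M : ℕ,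
    |∑ m ∈ Finset.range M, (Int.fract (α * ((m + 1 : ℕ) : ℝ)) - 1 / 2)| ≤ η * M + C := by
  obtain ⟨K, hK⟩ := exists_nat_gt (3 / η)
  obtain ⟨p, q, hKq, hpq, h⟩ := exists_good hirr K
  have hq : 0 < q := by omega
  have hqη : 3 ≤ η * q := by
    have : (K : ℝ) < q := by exact_mod_cast hKq
    rw [div_lt_iff₀ hη] at hK
    nlinarith
  refine ⟨q, by positivity, ?_⟩
  intro M
  induction M using Nat.strong_induction_on with
  | _ M ih =>
    by_cases hM : M < q
    · calc _ ≤ ∑ m ∈ Finset.range M, |(Int.fract (α * ((m + 1 : ℕ) : ℝ)) - 1 / 2)| :=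
          Finset.abs_sum_le_sum_abs _ _
        _ ≤ ∑ m ∈ Finset.range M, (1 : ℝ) := by
          refine Finset.sum_le_sum fun m _ => ?_
          have h0 := Int.fract_nonneg (α * ((m + 1 : ℕ) : ℝ))
          have h1 := Int.fract_lt_one (α * ((m + 1 : ℕ) : ℝ))
          rw [abs_le]; constructor <;> linarith
        _ = M := by simp
        _ ≤ q := by exact_mod_cast hM.le
        _ ≤ _ := by have : 0 ≤ η * M := by positivity
                    linarith
    · push Not at hM
      obtain ⟨N, rfl⟩ : ∃ N, M = N + q := ⟨M - q, by omega⟩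
      rw [Finset.sum_range_add]
      have h1 := ih N (by omega)
      have h2 := block p q hq hpq h (N + 1)
      have h3 : ∀ x : ℕ, N + x + 1 = N + 1 + x := by intro x; ring
      simp_rw [h3]
      refine (abs_add_le _ _).trans ?_
      push_cast at h1 h2 ⊢
      linarith

/-- Fermi function -/
noncomputable def fP (x : ℝ) : ℝ := 1 / (exp x + 1)
/-- logarithmic summand -/
noncomputable def fL (x : ℝ) : ℝ := log (1 + exp (-x))
/-- primitive of the logarithmic summand -/
noncomputable def fF (x : ℝ) : ℝ := ∫ t in (0:ℝ)..x, fL t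
/-- variance function -/
noncomputable def fQ (x : ℝ) : ℝ := fP x * (1 - fP x)

lemma fP_pos (x : ℝ) : 0 < fP x := by unfold fP; positivity

lemma fP_lt_one (x : ℝ) : fP x < 1 := by
  unfold fP
  rw [div_lt_one (by positivity)]
  linarith [exp_pos x]

lemma fP_le_exp (x : ℝ) : fP x ≤ exp (-x) := by
  unfold fP
  rw [exp_neg, ← one_div]
  gcongr
  linarith

lemma fP_eq (x : ℝ) : fP x = exp (-x) / (1 + exp (-x)) := by
  unfold fP
  rw [exp_neg]
  field_simp

lemma fQ_pos (x : ℝ) : 0 < fQ x := mul_pos (fP_pos x) (by linarith [fP_lt_one x])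

lemma fQ_le_exp (x : ℝ) : fQ x ≤ exp (-x) := by
  refine le_trans ?_ (fP_le_exp x)
  unfold fQ
  nlinarith [fP_pos x]

lemma fQ_ge {x : ℝ} (hx : 0 ≤ x) : exp (-x) / 4 ≤ fQ x := by
  have h : fQ x = exp (-x) / (1 + exp (-x)) ^ 2 := by
    unfold fQ
    rw [fP_eq]
    have := exp_pos (-x)
    field_simp
    ring
  rw [h]
  have h1 : exp (-x) ≤ 1 := by rw [exp_le_one_iff]; linarith
  have h0 := exp_pos (-x)
  gcongr
  nlinarith

lemma fL_pos (x : ℝ) : 0 < fL x := log_pos (by linarith [exp_pos (-x)])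

lemma fL_le_exp (x : ℝ) : fL x ≤ exp (-x) := by
  unfold fL
  have := log_le_sub_one_of_pos (show 0 < 1 + exp (-x) by positivity)
  linarith

lemma hasDerivAt_fL (x : ℝ) : HasDerivAt fL (-fP x) x := by
  have h1 : HasDerivAt (fun x : ℝ => 1 + exp (-x)) (exp (-x) * (-1)) x :=
    ((hasDerivAt_neg x).exp).const_add 1
  have h2 := h1.log (by positivity)
  exact h2.congr_deriv (by rw [fP_eq]; ring)

lemma hasDerivAt_fP (x : ℝ) : HasDerivAt fP (-fQ x) x := by
  have h1 : HasDerivAt (fun x : ℝ => exp x + 1) (exp x) x := (Real.hasDerivAt_exp x).add_const 1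
  have h2 := h1.inv (by positivity)
  have e : fP = (fun x : ℝ => exp x + 1)⁻¹ := by ext y; simp [fP]
  rw [e]
  exact h2.congr_deriv (by
    simp only [fQ, fP]
    field_simp
    ring)

lemma hasDerivAt_fQ (x : ℝ) : HasDerivAt fQ (-(fQ x * (1 - 2 * fP x))) x := by
  have h := (hasDerivAt_fP x).mul ((hasDerivAt_fP x).const_sub 1)
  exact h.congr_deriv (by
    simp only [fQ]
    ring)

lemma continuous_fL : Continuous fL :=
  continuous_iff_continuousAt.2 fun x => (hasDerivAt_fL x).continuousAt

lemma hasDerivAt_fF (x : ℝ) : HasDerivAt fF (fL x) x :=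
  intervalIntegral.integral_hasDerivAt_right (continuous_fL.intervalIntegrable _ _)
    (continuous_fL.stronglyMeasurableAtFilter _ _) continuous_fL.continuousAt

lemma HasSum.congr_fun' {f g : ℕ → ℝ} {a : ℝ} (h : HasSum f a) (e : ∀ n, g n = f n) :
    HasSum g a := by
  rwa [show g = f from funext e]

lemma hasSum_alt : HasSum (fun n : ℕ => (-1 : ℝ) ^ n / ((n : ℝ) + 1) ^ 2) (π ^ 2 / 12) := by
  have hz := hasSum_zeta_two
  have he : HasSum (fun k : ℕ => 1 / (((2 * k : ℕ) : ℝ)) ^ 2) (π ^ 2 / 24) := by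
    have := hz.mul_left (1 / 4)
    rw [show (1 / 4 : ℝ) * (π ^ 2 / 6) = π ^ 2 / 24 by ring] at this
    refine this.congr_fun' fun k => ?_
    push_cast
    rw [mul_pow]
    ring
  have hos : Summable (fun k : ℕ => 1 / (((2 * k + 1 : ℕ) : ℝ)) ^ 2) :=
    hz.summable.comp_injective (i := fun k : ℕ => 2 * k + 1) (by intro a b h; simpa using h)
  obtain ⟨o, ho⟩ := hos
  have h1 := HasSum.even_add_odd (f := fun n : ℕ => 1 / (n : ℝ) ^ 2) he ho
  have h2 := h1.unique hz
  have h3 : HasSum (fun n : ℕ => (-1 : ℝ) ^ n / ((n : ℝ) + 1) ^ 2) (o + -(π ^ 2 / 24)) := by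
    apply HasSum.even_add_odd
    · refine ho.congr_fun' fun k => ?_
      simp
    · have he' := (hasSum_nat_add_iff' 1).2 he
      simp only [Finset.range_one, Finset.sum_singleton] at he'
      norm_num at he'
      refine he'.neg.congr_fun' fun k => ?_
      push_cast
      rw [show (-1 : ℝ) ^ (2 * k + 1) = -1 by rw [pow_succ, pow_mul]; norm_num]
      have : (2 * (k : ℝ) + 1 + 1) = 2 * (k + 1) := by ring
      rw [this]
      field_simp
  rwa [show o + -(π ^ 2 / 24) = π ^ 2 / 12 by linarith] at h3

lemma integral_fL : ∫ x in Set.Ioi (0:ℝ), fL x = π ^ 2 / 12 := by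
  set G : ℕ → ℝ → ℝ := fun n x => (-1 : ℝ) ^ n / ((n : ℝ) + 1) * exp (-((n : ℝ) + 1) * x) with hG
  have hIoiInt : ∀ n : ℕ, ∫ x in Set.Ioi (0:ℝ), exp (-((n : ℝ) + 1) * x) = 1 / ((n : ℝ) + 1) := by
    intro n
    rw [integral_exp_mul_Ioi (by linarith [(Nat.cast_nonneg n : (0:ℝ) ≤ n)])]
    rw [mul_zero, exp_zero, ← neg_div_neg_eq]
    simp
  have hig : ∀ n : ℕ, MeasureTheory.IntegrableOn (fun x => exp (-((n : ℝ) + 1) * x)) (Set.Ioi (0:ℝ)) := by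
    intro n
    exact integrableOn_exp_mul_Ioi (by linarith [(Nat.cast_nonneg n : (0:ℝ) ≤ n)]) 0
  have h := MeasureTheory.hasSum_integral_of_summable_integral_norm
    (μ := MeasureTheory.volume.restrict (Set.Ioi (0:ℝ))) (F := G)
    (fun n => (hig n).const_mul _) (by
      have : ∀ n, ∫ x in Set.Ioi (0:ℝ), ‖G n x‖ = 1 / ((n + 1 : ℕ) : ℝ) ^ 2 := by
        intro n
        have : ∀ x, ‖G n x‖ = 1 / ((n : ℝ) + 1) * exp (-((n : ℝ) + 1) * x) := by
          intro x
          rw [hG, norm_mul, norm_div, norm_pow]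
          simp only [norm_neg, norm_one, one_pow, Real.norm_eq_abs, abs_exp]
          rw [abs_of_nonneg (by positivity)]
        simp_rw [this]
        rw [MeasureTheory.integral_const_mul, hIoiInt]
        push_cast
        rw [sq, one_div_mul_one_div]
      simp_rw [this]
      exact hasSum_zeta_two.summable.comp_injective (i := fun k : ℕ => k + 1)
        (by intro a b h; simpa using h))
  have h1 : ∀ n, ∫ x in Set.Ioi (0:ℝ), G n x = (-1 : ℝ) ^ n / ((n : ℝ) + 1) ^ 2 := by
    intro n
    rw [hG, MeasureTheory.integral_const_mul, hIoiInt]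
    rw [sq, div_mul_div_comm, mul_one]
  simp_rw [h1] at h
  rw [← h.unique hasSum_alt]
  refine MeasureTheory.setIntegral_congr_fun measurableSet_Ioi ?_
  intro x hx
  have hx' : (0:ℝ) < x := hx
  have h2 := Real.hasSum_pow_div_log_of_abs_lt_one (x := -exp (-x)) (by
    rw [abs_neg, abs_exp, exp_lt_one_iff]; linarith)
  have h3 := h2.neg
  rw [neg_neg, sub_neg_eq_add] at h3
  have h4 : HasSum (fun n => G n x) (fL x) := by
    refine h3.congr_fun' fun n => ?_
    simp only [hG]
    rw [show -((n : ℝ) + 1) * x = ((n + 1 : ℕ) : ℝ) * (-x) by push_cast; ring, exp_nat_mul,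
      neg_pow (exp (-x))]
    ring
  exact h4.tsum_eq.symm

lemma tendsto_fF : Tendsto fF atTop (𝓝 (π ^ 2 / 12)) := by
  rw [← integral_fL]
  apply MeasureTheory.intervalIntegral_tendsto_integral_Ioi _ _ tendsto_id
  have hi : MeasureTheory.IntegrableOn (fun x => exp (-1 * x)) (Set.Ioi (0:ℝ)) :=
    integrableOn_exp_mul_Ioi (by norm_num) 0
  refine MeasureTheory.Integrable.mono' hi continuous_fL.aestronglyMeasurable ?_
  filter_upwards with x
  rw [Real.norm_eq_abs, abs_of_pos (fL_pos x), neg_one_mul]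
  exact fL_le_exp x

lemma fF_zero : fF 0 = 0 := by simp [fF]

lemma fL_zero : fL 0 = log 2 := by simp [fL]; norm_num

lemma fF_bound (x : ℝ) : |fF x - π ^ 2 / 12| ≤ exp (-x) := by
  have hm : Monotone fF := monotone_of_hasDerivAt_nonneg hasDerivAt_fF (fun x => (fL_pos x).le)
  have ha : Antitone (fun x => fF x + exp (-x)) := by
    apply antitone_of_hasDerivAt_nonpos (f' := fun x => fL x + exp (-x) * (-1))
    · intro x
      exact (hasDerivAt_fF x).add ((hasDerivAt_neg x).exp)
    · intro x
      have := fL_le_exp x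
      simp only [Pi.zero_apply]
      linarith
  have h1 : fF x ≤ π ^ 2 / 12 := hm.ge_of_tendsto tendsto_fF x
  have h2 : Tendsto (fun x => fF x + exp (-x)) atTop (𝓝 (π ^ 2 / 12 + 0)) :=
    tendsto_fF.add (tendsto_exp_neg_atTop_nhds_zero)
  have h3 := ha.le_of_tendsto h2 x
  rw [abs_le]; constructor <;> linarith [exp_pos (-x)]

lemma geo_sum {t : ℝ} (ht : 0 < t) (M : ℕ) :
    ∑ m ∈ Finset.Icc 1 M, exp (-(t * ((m : ℝ) - 1))) ≤ 1 + 1 / t := by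
  have h1 : ∑ m ∈ Finset.Icc 1 M, exp (-(t * ((m : ℝ) - 1))) = ∑ i ∈ Finset.range M, exp (-t) ^ i := by
    rw [Finset.range_eq_Ico, Finset.sum_Ico_eq_sum_range, ← Finset.Ico_add_one_right_eq_Icc,
      Finset.sum_Ico_eq_sum_range]
    simp only [Nat.add_sub_cancel, Nat.sub_zero]
    refine Finset.sum_congr rfl fun i _ => ?_
    rw [← exp_nat_mul]
    congr 1
    push_cast
    ring
  have hlt : exp (-t) < 1 := by rw [exp_lt_one_iff]; linarith
  rw [h1]
  have h2 : ∑ i ∈ Finset.range M, exp (-t) ^ i ≤ (1 - exp (-t))⁻¹ := by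
    rw [← tsum_geometric_of_lt_one (exp_pos _).le hlt]
    exact (summable_geometric_of_lt_one (exp_pos _).le hlt).sum_le_tsum _ (fun i _ => by positivity)
  refine h2.trans ?_
  have h3 : 1 + t ≤ exp t := by linarith [add_one_le_exp t]
  have h4 : exp (-t) ≤ 1 / (1 + t) := by
    rw [exp_neg, ← one_div]; gcongr
  have h5 : t / (1 + t) ≤ 1 - exp (-t) := by
    have : t / (1 + t) = 1 - 1 / (1 + t) := by field_simp; ring
    linarith
  calc (1 - exp (-t))⁻¹ ≤ (t / (1 + t))⁻¹ := by gcongr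
    _ = 1 + 1 / t := by field_simp; ring

lemma mvt_abs {g g' : ℝ → ℝ} (hg : ∀ x, HasDerivAt g (g' x) x) {a b K : ℝ}
    (hK : ∀ x, a ≤ x → x ≤ b → |g' x| ≤ K) {x y : ℝ} (hx : x ∈ Set.Icc a b) (hy : y ∈ Set.Icc a b) :
    |g x - g y| ≤ K * |x - y| := by
  have := (convex_Icc a b).norm_image_sub_le_of_norm_hasDerivWithin_le (f := g) (f' := g') (C := K)
    (fun z _ => (hg z).hasDerivWithinAt) (fun z hz => hK z hz.1 hz.2) hy hx
  simpa [Real.norm_eq_abs] using this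

lemma mvt_eq {g g' : ℝ → ℝ} (hg : ∀ x, HasDerivAt g (g' x) x) {a b : ℝ} (hab : a ≤ b) :
    ∃ z ∈ Set.Icc a b, g b - g a = (b - a) * g' z := by
  rcases hab.eq_or_lt with h | h
  · exact ⟨a, ⟨le_rfl, hab⟩, by rw [h]; ring⟩
  · obtain ⟨z, hz, e⟩ := exists_hasDerivAt_eq_slope g g' h
      (fun x _ => (hg x).continuousAt.continuousWithinAt) (fun x _ => hg x)
    refine ⟨z, ⟨hz.1.le, hz.2.le⟩, ?_⟩
    rw [e]
    have : b - a ≠ 0 := by linarith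
    field_simp

lemma telesc (H : ℝ → ℝ) (h : ℝ) (M : ℕ) :
    ∑ m ∈ Finset.Icc 1 M, (H (h * m) - H (h * ((m : ℝ) - 1))) = H (h * M) - H 0 := by
  induction M with
  | zero => simp
  | succ k ih =>
    rw [Finset.sum_Icc_succ_top (by omega), ih]
    push_cast
    rw [add_sub_cancel_right]
    ring

lemma riemann {g g' H : ℝ → ℝ} {C : ℝ} (hC : 0 ≤ C) (hH : ∀ x, HasDerivAt H (g x) x)
    (hg : ∀ x, HasDerivAt g (g' x) x) (hb : ∀ x, 0 ≤ x → |g' x| ≤ C * exp (-(x / 2)))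
    {h : ℝ} (hh : 0 < h) (ξ : ℕ → ℝ)
    (hξ : ∀ m : ℕ, ξ m ∈ Set.Icc (h * ((m : ℝ) - 1)) (h * m)) (M : ℕ) :
    |∑ m ∈ Finset.Icc 1 M, g (ξ m) - (H (h * M) - H 0) / h| ≤ C * (h + 2) := by
  rw [← telesc, Finset.sum_div, ← Finset.sum_sub_distrib]
  refine (Finset.abs_sum_le_sum_abs _ _).trans ?_
  have h1 : ∀ m ∈ Finset.Icc 1 M, |g (ξ m) - (H (h * m) - H (h * ((m : ℝ) - 1))) / h| ≤
      C * h * exp (-(h / 2 * ((m : ℝ) - 1))) := by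
    intro m hm
    have hm1 : (1 : ℝ) ≤ m := by exact_mod_cast (Finset.mem_Icc.1 hm).1
    obtain ⟨z, hz, e⟩ := mvt_eq hH (a := h * ((m : ℝ) - 1)) (b := h * m) (by nlinarith)
    have e2 : (H (h * m) - H (h * ((m : ℝ) - 1))) / h = g z := by
      rw [e]; field_simp; ring
    rw [e2]
    refine (mvt_abs hg (K := C * exp (-(h / 2 * ((m : ℝ) - 1)))) ?_ (hξ m) hz).trans ?_
    · intro x hx _
      refine (hb x (le_trans (by nlinarith) hx)).trans ?_
      gcongr
      linarith
    · have : |ξ m - z| ≤ h := by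
        have := (hξ m).1
        have := (hξ m).2
        have := hz.1
        have := hz.2
        rw [abs_le]; constructor <;> linarith
      calc _ ≤ C * exp (-(h / 2 * ((m : ℝ) - 1))) * h := by gcongr
        _ = _ := by ring
  refine (Finset.sum_le_sum h1).trans ?_
  rw [← Finset.mul_sum]
  calc _ ≤ C * h * (1 + 1 / (h / 2)) := by
        gcongr
        exact geo_sum (by positivity) M
    _ = _ := by field_simp

lemma abel_bound (w x : ℕ → ℝ) (hw : Antitone w) (hw0 : ∀ m, 0 ≤ w m) {η C : ℝ}
    (hS : ∀ M, |∑ m ∈ Finset.range M, x m| ≤ η * M + C) (M : ℕ) :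
    |∑ m ∈ Finset.range M, w m * x m| ≤ η * ∑ m ∈ Finset.range M, w m + C * w 0 := by
  have key : |∑ m ∈ Finset.range M, w m * x m - w M * ∑ m ∈ Finset.range M, x m| ≤
      η * ∑ m ∈ Finset.range M, w m + C * w 0 - w M * (η * M + C) := by
    induction M with
    | zero => simp; linarith
    | succ k ih =>
      have h1 := hS (k + 1)
      rw [Finset.sum_range_succ, Finset.sum_range_succ (f := w)]
      have e : ∑ m ∈ Finset.range k, w m * x m + w k * x k -
          w (k + 1) * ∑ m ∈ Finset.range (k + 1), x m =
          (∑ m ∈ Finset.range k, w m * x m - w k * ∑ m ∈ Finset.range k, x m) +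
          (w k - w (k + 1)) * ∑ m ∈ Finset.range (k + 1), x m := by
        rw [Finset.sum_range_succ (f := x)]; ring
      rw [e]
      refine (abs_add_le _ _).trans ?_
      have hd : 0 ≤ w k - w (k + 1) := sub_nonneg.2 (hw (Nat.le_succ k))
      rw [abs_mul, abs_of_nonneg hd]
      have := mul_le_mul_of_nonneg_left h1 hd
      push_cast at this ⊢
      nlinarith
  have h2 : |w M * ∑ m ∈ Finset.range M, x m| ≤ w M * (η * M + C) := by
    rw [abs_mul, abs_of_nonneg (hw0 M)]
    exact mul_le_mul_of_nonneg_left (hS M) (hw0 M)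
  have h3 := abs_add_le (∑ m ∈ Finset.range M, w m * x m - w M * ∑ m ∈ Finset.range M, x m)
    (w M * ∑ m ∈ Finset.range M, x m)
  rw [sub_add_cancel] at h3
  linarith

lemma fQ_abs_le {a x : ℝ} (h : a ≤ x) : |-fQ x| ≤ exp (-a) := by
  rw [abs_neg, abs_of_pos (fQ_pos x)]
  exact (fQ_le_exp x).trans (by gcongr)

/-- second order expansion of fL -/
lemma taylor_fL {a b s : ℝ} (hs : 0 ≤ s) (hsb : a ≤ b - s) :
    |fL (b - s) - fL b - s * fP b| ≤ s ^ 2 * exp (-a) := by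
  obtain ⟨z, hz, e⟩ := mvt_eq hasDerivAt_fL (a := b - s) (b := b) (by linarith)
  have h1 := mvt_abs hasDerivAt_fP (a := a) (b := b) (K := exp (-a))
    (fun x hx _ => fQ_abs_le hx) (x := z) (y := b) ⟨by linarith [hz.1], hz.2⟩ ⟨by linarith, le_rfl⟩
  have e2 : fL (b - s) - fL b - s * fP b = s * (fP z - fP b) := by
    have : fL b - fL (b - s) = s * (-fP z) := by rw [e]; ring
    linarith
  rw [e2, abs_mul, abs_of_nonneg hs]
  have h3 : |z - b| ≤ s := by
    rw [abs_le]; constructor <;> linarith [hz.1, hz.2]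
  calc s * |fP z - fP b| ≤ s * (exp (-a) * s) := by
        gcongr
        exact h1.trans (by gcongr)
    _ = _ := by ring

lemma trapezoid {a h : ℝ} (hh : 0 ≤ h) :
    |fF (a + h) - fF a - h * (fL a + fL (a + h)) / 2| ≤ h ^ 3 * exp (-a) := by
  set ψ : ℝ → ℝ := fun t => fF (a + t) - fF a - t * (fL a + fL (a + t)) / 2 with hψ
  have hd : ∀ t, HasDerivAt ψ ((fL (a + t) - fL a) / 2 + t * fP (a + t) / 2) t := by
    intro t
    have h1 : HasDerivAt (fun t => fF (a + t)) (fL (a + t)) t := by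
      simpa using (hasDerivAt_fF (a + t)).comp_const_add a t
    have h2 : HasDerivAt (fun t => fL (a + t)) (-fP (a + t)) t := by
      simpa using (hasDerivAt_fL (a + t)).comp_const_add a t
    have h3 := ((h1.sub_const (fF a)).sub
      (((hasDerivAt_id t).mul (h2.const_add (fL a))).div_const 2))
    exact h3.congr_deriv (by simp only [id]; ring)
  have h0 : ψ 0 = 0 := by simp [hψ]
  have hb := mvt_abs hd (a := 0) (b := h) (K := h ^ 2 * exp (-a)) (x := h) (y := 0) (by
    intro t ht hth
    have := taylor_fL (a := a) (b := a + t) (s := t) ht (by linarith)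
    rw [add_sub_cancel_right] at this
    have e : (fL (a + t) - fL a) / 2 + t * fP (a + t) / 2 =
      -(fL a - fL (a + t) - t * fP (a + t)) / 2 := by ring
    rw [e, abs_div, abs_neg, abs_two]
    have h5 : t ^ 2 * exp (-a) ≤ h ^ 2 * exp (-a) := by gcongr
    have : 0 ≤ h ^ 2 * exp (-a) := by positivity
    linarith) ⟨hh, le_rfl⟩ ⟨le_rfl, hh⟩
  rw [h0, sub_zero, sub_zero, abs_of_nonneg hh] at hb
  calc _ ≤ h ^ 2 * exp (-a) * h := hb
    _ = _ := by ring

lemma sum_Icc_range (f : ℕ → ℝ) (M : ℕ) :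
    ∑ m ∈ Finset.Icc 1 M, f m = ∑ m ∈ Finset.range M, f (m + 1) := by
  induction M with
  | zero => simp
  | succ k ih => rw [Finset.sum_Icc_succ_top (by omega), Finset.sum_range_succ, ih]

lemma bt_eq {α : ℝ} (hα : 1 < α) (m : ℕ) : (bt α m : ℝ) = α * m - Int.fract (α * m) := by
  have h := bt_int hα m
  have h2 : ((bt α m : ℕ) : ℝ) = ((⌊α * m⌋ : ℤ) : ℝ) := by rw [← h]; simp
  rw [h2, Int.fract]
  ring

lemma tag_mem {α : ℝ} (hα : 1 < α) {τ : ℝ} (hτ : 0 < τ) (m : ℕ) :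
    τ * bt α m ∈ Set.Icc (α * τ * ((m : ℝ) - 1)) (α * τ * m) := by
  have h1 := bt_le hα m
  have h2 := bt_gt (α := α) m
  constructor
  · have : τ * (α * m - α) ≤ τ * bt α m := by gcongr; linarith
    linarith
  · have : τ * bt α m ≤ τ * (α * m) := by gcongr
    linarith

lemma S1_bound {α : ℝ} (hα : 1 < α) {η C : ℝ} (hη : 0 ≤ η) (hC : 0 ≤ C)
    (hS : ∀ M : ℕ, |∑ m ∈ Finset.range M, (Int.fract (α * ((m + 1 : ℕ) : ℝ)) - 1 / 2)| ≤ η * M + C)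
    {τ : ℝ} (hτ : 0 < τ) (M : ℕ) :
    |∑ m ∈ Finset.Icc 1 M, fL (τ * bt α m) - fF (α * τ * M) / (α * τ) -
      (-1 / 2 + 1 / (2 * α)) * log 2| ≤
    2 * (α * τ * (α * τ + 1)) + τ * (α * τ + 2) + exp (-(α * τ * M)) + η * (τ + 1) + τ * C := by
  set h := α * τ with hh
  have hh0 : 0 < h := by positivity
  have hτh : τ ≤ h := by rw [hh]; nlinarith
  -- T1
  have hT1 : |∑ m ∈ Finset.Icc 1 M, (fL (τ * bt α m) - fL (h * m) -
      τ * Int.fract (α * m) * fP (h * m))| ≤ h * (h + 1) := by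
    refine (Finset.abs_sum_le_sum_abs _ _).trans ?_
    have h1 : ∀ m ∈ Finset.Icc 1 M, |fL (τ * bt α m) - fL (h * m) -
      τ * Int.fract (α * m) * fP (h * m)| ≤ h ^ 2 * exp (-(h * ((m : ℝ) - 1))) := by
      intro m _
      have f0 := Int.fract_nonneg (α * m)
      have f1 := (Int.fract_lt_one (α * m)).le
      have e : τ * bt α m = h * m - τ * Int.fract (α * m) := by rw [bt_eq hα, hh]; ring
      have hs : τ * Int.fract (α * m) ≤ h := by nlinarith
      rw [e]
      refine (taylor_fL (a := h * ((m : ℝ) - 1)) (by positivity) (by linarith)).trans ?_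
      gcongr
    refine (Finset.sum_le_sum h1).trans ?_
    rw [← Finset.mul_sum]
    calc _ ≤ h ^ 2 * (1 + 1 / h) := by gcongr; exact geo_sum hh0 M
      _ = _ := by field_simp
  -- T2
  have hT2 : |∑ m ∈ Finset.Icc 1 M, fL (h * m) - fF (h * M) / h + log 2 / 2 - fL (h * M) / 2| ≤
      h * (h + 1) := by
    have e : ∑ m ∈ Finset.Icc 1 M, fL (h * m) - fF (h * M) / h + log 2 / 2 - fL (h * M) / 2 =
        -(1 / h) * ∑ m ∈ Finset.Icc 1 M, ((fF (h * m) - fF (h * ((m : ℝ) - 1))) -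
          h * (fL (h * ((m : ℝ) - 1)) + fL (h * m)) / 2) := by
      have t1 := telesc fF h M
      have t2 := telesc fL h M
      rw [fF_zero] at t1
      rw [fL_zero] at t2
      rw [Finset.sum_sub_distrib, t1]
      have t3 : ∑ m ∈ Finset.Icc 1 M, h * (fL (h * ((m : ℝ) - 1)) + fL (h * m)) / 2 =
          h * (∑ m ∈ Finset.Icc 1 M, fL (h * m) -
            (∑ m ∈ Finset.Icc 1 M, (fL (h * m) - fL (h * ((m : ℝ) - 1)))) / 2) := by
        rw [Finset.sum_div, ← Finset.sum_sub_distrib, Finset.mul_sum]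
        refine Finset.sum_congr rfl fun m _ => ?_
        ring
      rw [t3, t2]
      field_simp
      ring
    rw [e, abs_mul, abs_neg, abs_of_pos (show 0 < 1 / h by positivity)]
    have h1 : ∀ m ∈ Finset.Icc 1 M, |(fF (h * m) - fF (h * ((m : ℝ) - 1))) -
          h * (fL (h * ((m : ℝ) - 1)) + fL (h * m)) / 2| ≤ h ^ 3 * exp (-(h * ((m : ℝ) - 1))) := by
      intro m _
      have := trapezoid (a := h * ((m : ℝ) - 1)) hh0.le
      rwa [show h * ((m : ℝ) - 1) + h = h * m by ring] at this
    calc _ ≤ (1 / h) * ∑ m ∈ Finset.Icc 1 M, h ^ 3 * exp (-(h * ((m : ℝ) - 1))) := by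
          gcongr
          exact (Finset.abs_sum_le_sum_abs _ _).trans (Finset.sum_le_sum h1)
      _ = (1 / h) * (h ^ 3 * ∑ m ∈ Finset.Icc 1 M, exp (-(h * ((m : ℝ) - 1)))) := by
          rw [← Finset.mul_sum]
      _ ≤ (1 / h) * (h ^ 3 * (1 + 1 / h)) := by gcongr; exact geo_sum hh0 M
      _ = _ := by field_simp
  -- T3
  have hT3 : |∑ m ∈ Finset.Icc 1 M, fP (h * m) - (log 2 - fL (h * M)) / h| ≤ h + 2 := by
    have := riemann (g := fP) (g' := fun x => -fQ x) (H := fun x => -fL x) (C := 1) zero_le_one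
      (fun x => (hasDerivAt_fL x).neg.congr_deriv (neg_neg _)) hasDerivAt_fP
      (fun x hx => by
        rw [one_mul]
        exact fQ_abs_le (by linarith)) hh0 (fun m => h * m)
      (fun m => ⟨by linarith, le_rfl⟩) M
    rw [fL_zero, one_mul] at this
    rwa [show log 2 - fL (h * M) = -fL (h * M) - -log 2 by ring]
  -- T4
  have hT4 : |∑ m ∈ Finset.Icc 1 M, fP (h * m) * (Int.fract (α * m) - 1 / 2)| ≤
      η * (1 + 1 / h) + C := by
    rw [sum_Icc_range (fun m => fP (h * m) * (Int.fract (α * m) - 1 / 2))]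
    have hanti : Antitone fP := by
      apply antitone_of_hasDerivAt_nonpos hasDerivAt_fP
      intro x
      simp only [Pi.zero_apply]
      linarith [fQ_pos x]
    have := abel_bound (fun m => fP (h * ((m + 1 : ℕ) : ℝ)))
      (fun m => Int.fract (α * ((m + 1 : ℕ) : ℝ)) - 1 / 2)
      (by
        intro a b hab
        apply hanti
        gcongr) (fun m => (fP_pos _).le) hS M
    refine this.trans ?_
    rw [← sum_Icc_range (fun m => fP (h * m))]
    have g1 : ∑ m ∈ Finset.Icc 1 M, fP (h * m) ≤ 1 + 1 / h := by
      refine le_trans (Finset.sum_le_sum fun m _ => ?_) (geo_sum hh0 M)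
      refine (fP_le_exp _).trans ?_
      gcongr
      linarith
    have g2 : fP (h * ((0 + 1 : ℕ) : ℝ)) ≤ 1 := (fP_lt_one _).le
    gcongr
    nlinarith
  have hfin : ∑ m ∈ Finset.Icc 1 M, fL (τ * bt α m) - fF (h * M) / h -
      (-1 / 2 + 1 / (2 * α)) * log 2 =
      ∑ m ∈ Finset.Icc 1 M, (fL (τ * bt α m) - fL (h * m) -
      τ * Int.fract (α * m) * fP (h * m)) +
      (∑ m ∈ Finset.Icc 1 M, fL (h * m) - fF (h * M) / h + log 2 / 2 - fL (h * M) / 2) +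
      τ / 2 * (∑ m ∈ Finset.Icc 1 M, fP (h * m) - (log 2 - fL (h * M)) / h) +
      τ * (∑ m ∈ Finset.Icc 1 M, fP (h * m) * (Int.fract (α * m) - 1 / 2)) +
      (1 / 2 - 1 / (2 * α)) * fL (h * M) := by
    have e1 : ∑ m ∈ Finset.Icc 1 M, (fL (τ * bt α m) - fL (h * m) -
      τ * Int.fract (α * m) * fP (h * m)) = ∑ m ∈ Finset.Icc 1 M, fL (τ * bt α m) -
      ∑ m ∈ Finset.Icc 1 M, fL (h * m) -
      τ * (∑ m ∈ Finset.Icc 1 M, fP (h * m) * (Int.fract (α * m) - 1 / 2)) -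
      τ / 2 * ∑ m ∈ Finset.Icc 1 M, fP (h * m) := by
      rw [Finset.mul_sum, Finset.mul_sum, ← Finset.sum_sub_distrib, ← Finset.sum_sub_distrib,
        ← Finset.sum_sub_distrib]
      refine Finset.sum_congr rfl fun m _ => ?_
      ring
    rw [e1]
    have e2 : τ / 2 * ((log 2 - fL (h * M)) / h) = 1 / (2 * α) * (log 2 - fL (h * M)) := by
      rw [hh]; field_simp
    rw [mul_sub (τ / 2), e2]
    ring
  rw [hfin]
  have b5 : |(1 / 2 - 1 / (2 * α)) * fL (h * M)| ≤ exp (-(h * M)) := by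
    have i1 : 1 / (2 * α) ≤ 1 / 2 := by gcongr; linarith
    have i2 : 0 < 1 / (2 * α) := by positivity
    have i3 := fL_pos (h * M)
    have i4 := fL_le_exp (h * M)
    rw [abs_mul, abs_of_nonneg (by linarith), abs_of_pos i3]
    nlinarith
  have b3 : |τ / 2 * (∑ m ∈ Finset.Icc 1 M, fP (h * m) - (log 2 - fL (h * M)) / h)| ≤
      τ * (h + 2) := by
    rw [abs_mul, abs_of_pos (by positivity)]
    calc _ ≤ τ / 2 * (h + 2) := by gcongr
      _ ≤ _ := by nlinarith
  have b4 : |τ * (∑ m ∈ Finset.Icc 1 M, fP (h * m) * (Int.fract (α * m) - 1 / 2))| ≤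
      η * (τ + 1) + τ * C := by
    rw [abs_mul, abs_of_pos hτ]
    calc _ ≤ τ * (η * (1 + 1 / h) + C) := by gcongr
      _ = η * (τ + τ / h) + τ * C := by ring
      _ ≤ _ := by
        gcongr
        rw [div_le_one hh0]; exact hτh
  refine (abs_add_le _ _).trans ?_
  refine (add_le_add_left (abs_add_le _ _) _).trans ?_
  refine (add_le_add_left (add_le_add_left (abs_add_le _ _) _) _).trans ?_
  refine (add_le_add_left (add_le_add_left (add_le_add_left (abs_add_le _ _) _) _) _).trans ?_
  linarith

/-- primitive of `x * fP x` -/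
noncomputable def fG (x : ℝ) : ℝ := fF x - x * fL x

lemma hasDerivAt_fG (x : ℝ) : HasDerivAt fG (x * fP x) x := by
  have := (hasDerivAt_fF x).sub ((hasDerivAt_id x).mul (hasDerivAt_fL x))
  exact this.congr_deriv (by simp only [id]; ring)

lemma S2_bound {α : ℝ} (hα : 1 < α) {τ : ℝ} (hτ : 0 < τ) (M : ℕ) :
    |∑ m ∈ Finset.Icc 1 M, (τ * bt α m) * fP (τ * bt α m) - fG (α * τ * M) / (α * τ)| ≤
      2 * (α * τ + 2) := by
  have := riemann (g := fun x => x * fP x) (g' := fun x => fP x + x * (-fQ x)) (H := fG) (C := 2)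
    zero_le_two hasDerivAt_fG
    (fun x => ((hasDerivAt_id x).mul (hasDerivAt_fP x)).congr_deriv (by simp only [id]; ring))
    (fun x hx => by
      have p1 := fP_pos x
      have p2 := fP_le_exp x
      have q1 := fQ_pos x
      have q2 := fQ_le_exp x
      have e1 : exp (-x) = exp (-(x / 2)) * exp (-(x / 2)) := by rw [← exp_add]; congr 1; ring
      have e2 : 1 + x / 2 ≤ exp (x / 2) := by linarith [add_one_le_exp (x / 2)]
      have e3 : exp (-(x / 2)) * exp (x / 2) = 1 := by rw [← exp_add]; simp
      have e4 := exp_pos (-(x / 2))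
      have e5 : exp (-(x / 2)) * (1 + x / 2) ≤ 1 := (mul_le_mul_of_nonneg_left e2 e4.le).trans_eq e3
      have e6 : (1 + x) * exp (-x) ≤ 2 * exp (-(x / 2)) := by
        rw [e1]; nlinarith
      have e7 : x * fQ x ≤ x * exp (-x) := by gcongr
      have e8 : 0 ≤ x * fQ x := by positivity
      rw [abs_le]; constructor <;> nlinarith)
    (show 0 < α * τ by positivity) (fun m => τ * bt α m) (tag_mem hα hτ) M
  have h0 : fG 0 = 0 := by simp [fG, fF_zero]
  rwa [h0, sub_zero] at this

/-- primitive of `x^2 * fQ x` -/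
noncomputable def fH (x : ℝ) : ℝ := 2 * fG x - x ^ 2 * fP x

lemma hasDerivAt_fH (x : ℝ) : HasDerivAt fH (x ^ 2 * fQ x) x := by
  have := ((hasDerivAt_fG x).const_mul 2).sub ((hasDerivAt_pow 2 x).mul (hasDerivAt_fP x))
  exact this.congr_deriv (by push_cast; ring)

lemma S3_bound {α : ℝ} (hα : 1 < α) {τ : ℝ} (hτ : 0 < τ) (M : ℕ) :
    |∑ m ∈ Finset.Icc 1 M, (τ * bt α m) ^ 2 * fQ (τ * bt α m) - fH (α * τ * M) / (α * τ)| ≤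
      8 * (α * τ + 2) := by
  have := riemann (g := fun x => x ^ 2 * fQ x)
    (g' := fun x => 2 * x * fQ x - x ^ 2 * fQ x * (1 - 2 * fP x)) (H := fH) (C := 8)
    (by norm_num) hasDerivAt_fH
    (fun x => ((hasDerivAt_pow 2 x).mul (hasDerivAt_fQ x)).congr_deriv (by push_cast; ring))
    (fun x hx => by
      have p1 := fP_pos x
      have p2 := fP_lt_one x
      have q1 := fQ_pos x
      have q2 := fQ_le_exp x
      have e1 : exp (-x) = exp (-(x / 2)) * exp (-(x / 2)) := by rw [← exp_add]; congr 1; ring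
      have e2 : 1 + x / 2 + (x / 2) ^ 2 / 2 ≤ exp (x / 2) := quadratic_le_exp_of_nonneg (by linarith)
      have e3 : exp (-(x / 2)) * exp (x / 2) = 1 := by rw [← exp_add]; simp
      have e4 := exp_pos (-(x / 2))
      have e5 : exp (-(x / 2)) * (1 + x / 2 + (x / 2) ^ 2 / 2) ≤ 1 := (mul_le_mul_of_nonneg_left e2 e4.le).trans_eq e3
      have e6 : (2 * x + x ^ 2) * exp (-x) ≤ 8 * exp (-(x / 2)) := by
        rw [e1]
        have : (2 * x + x ^ 2) * exp (-(x / 2)) ≤ 8 := by nlinarith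
        nlinarith
      have e7 : x * fQ x ≤ x * exp (-x) := by gcongr
      have e8 : 0 ≤ x * fQ x := by positivity
      have e9 : x ^ 2 * fQ x ≤ x ^ 2 * exp (-x) := by gcongr
      have e10 : 0 ≤ x ^ 2 * fQ x := by positivity
      have e11 : |x ^ 2 * fQ x * (1 - 2 * fP x)| ≤ x ^ 2 * fQ x := by
        rw [abs_mul, abs_of_nonneg e10]
        have : |1 - 2 * fP x| ≤ 1 := by rw [abs_le]; constructor <;> linarith
        nlinarith
      have e12 := abs_le.1 e11
      rw [abs_le]; constructor <;> nlinarith)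
    (show 0 < α * τ by positivity) (fun m => τ * bt α m) (tag_mem hα hτ) M
  have h0 : fH 0 = 0 := by simp [fH, fG, fF_zero]
  rwa [h0, sub_zero] at this

/-- main constant -/
noncomputable def cA (α : ℝ) : ℝ := π ^ 2 / (12 * α)
/-- saddle point -/
noncomputable def tau (α : ℝ) (n : ℕ) : ℝ := √(cA α / n)

lemma cA_pos {α : ℝ} (hα : 1 < α) : 0 < cA α := by unfold cA; positivity

lemma tau_pos {α : ℝ} (hα : 1 < α) {n : ℕ} (hn : 0 < n) : 0 < tau α n := by
  have := cA_pos hα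
  have : (0 : ℝ) < n := by exact_mod_cast hn
  unfold tau
  positivity

lemma tau_sq {α : ℝ} (hα : 1 < α) {n : ℕ} (hn : 0 < n) : tau α n ^ 2 * n = cA α := by
  have := cA_pos hα
  have : (0 : ℝ) < n := by exact_mod_cast hn
  unfold tau
  rw [sq_sqrt (by positivity)]
  field_simp

lemma tau_tendsto (α : ℝ) : Tendsto (tau α) atTop (𝓝 0) := by
  have h : Tendsto (fun n : ℕ => cA α / (n : ℝ)) atTop (𝓝 0) :=
    tendsto_const_div_atTop_nhds_zero_nat _
  have := h.sqrt
  rwa [sqrt_zero] at this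

lemma X_eq {α : ℝ} (hα : 1 < α) {n : ℕ} (hn : 0 < n) :
    α * tau α n * n = α * cA α * (tau α n)⁻¹ := by
  rw [← tau_sq hα hn]
  have := (tau_pos hα hn).ne'
  field_simp

lemma tau_tendsto_gt {α : ℝ} (hα : 1 < α) : Tendsto (tau α) atTop (𝓝[>] 0) := by
  rw [tendsto_nhdsWithin_iff]
  refine ⟨tau_tendsto α, ?_⟩
  filter_upwards [eventually_gt_atTop 0] with n hn using tau_pos hα hn

lemma X_tendsto {α : ℝ} (hα : 1 < α) :
    Tendsto (fun n : ℕ => α * tau α n * n) atTop atTop := by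
  have h1 : Tendsto (fun n : ℕ => (tau α n)⁻¹) atTop atTop :=
    tendsto_inv_nhdsGT_zero.comp (tau_tendsto_gt hα)
  have h2 := h1.const_mul_atTop (show 0 < α * cA α by have := cA_pos hα; positivity)
  refine h2.congr' ?_
  filter_upwards [eventually_gt_atTop 0] with n hn using (X_eq hα hn).symm

lemma Xpow_tendsto {α : ℝ} (hα : 1 < α) (k : ℕ) :
    Tendsto (fun n : ℕ => (α * tau α n * n) ^ k * exp (-(α * tau α n * n)) / (α * tau α n))
      atTop (𝓝 0) := by
  have h0 := tendsto_pow_mul_exp_neg_atTop_nhds_zero (k + 1)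
  have h1 := (h0.comp (X_tendsto hα)).const_mul (1 / (α ^ 2 * cA α))
  rw [mul_zero] at h1
  refine h1.congr' ?_
  filter_upwards [eventually_gt_atTop 0] with n hn
  have t := tau_pos hα hn
  have hn' : (0 : ℝ) < n := by exact_mod_cast hn
  simp only [Function.comp]
  rw [← tau_sq hα hn]
  field_simp
  ring

lemma L1 {α : ℝ} (hα : 1 < α) (hirr : Irrational α) :
    Tendsto (fun n : ℕ => ∑ m ∈ Finset.Icc 1 n, fL (tau α n * bt α m) - cA α / tau α n) atTop
      (𝓝 ((-1 / 2 + 1 / (2 * α)) * log 2)) := by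
  rw [Metric.tendsto_nhds]
  intro ε hε
  obtain ⟨C, hC, hS⟩ := equidist hirr (show 0 < ε / 2 by positivity)
  have hτ := tau_tendsto α
  have hX : Tendsto (fun n : ℕ => exp (-(α * tau α n * n))) atTop (𝓝 0) :=
    tendsto_exp_neg_atTop_nhds_zero.comp (X_tendsto hα)
  have hlim : Tendsto (fun n : ℕ => 2 * (α * tau α n * (α * tau α n + 1)) +
      tau α n * (α * tau α n + 2) + exp (-(α * tau α n * n)) + ε / 2 * (tau α n + 1) + tau α n * C
      + (α * tau α n * n) ^ 0 * exp (-(α * tau α n * n)) / (α * tau α n)) atTop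
      (𝓝 (2 * (α * 0 * (α * 0 + 1)) + 0 * (α * 0 + 2) + 0 + ε / 2 * (0 + 1) + 0 * C + 0)) := by
    refine ((((Tendsto.add ?_ ?_).add hX).add ?_).add ?_).add (Xpow_tendsto hα 0)
    · exact ((hτ.const_mul α).mul ((hτ.const_mul α).add_const 1)).const_mul 2
    · exact hτ.mul ((hτ.const_mul α).add_const 2)
    · exact (hτ.add_const 1).const_mul _
    · exact hτ.mul_const C
  filter_upwards [hlim.eventually_lt_const (show _ < ε by linarith), eventually_gt_atTop 0]
    with n hn hn0
  have t := tau_pos hα hn0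
  have h1 := S1_bound hα (by positivity) hC hS t n
  have h2 : |fF (α * tau α n * n) / (α * tau α n) - cA α / tau α n| ≤
      (α * tau α n * n) ^ 0 * exp (-(α * tau α n * n)) / (α * tau α n) := by
    have e : cA α / tau α n = (π ^ 2 / 12) / (α * tau α n) := by
      unfold cA; field_simp
    rw [e, ← sub_div, abs_div, abs_of_pos (show 0 < α * tau α n by positivity), pow_zero, one_mul]
    gcongr
    exact fF_bound _
  rw [Real.dist_eq]
  have h3 := abs_add_le (∑ m ∈ Finset.Icc 1 n, fL (tau α n * bt α m) -
    fF (α * tau α n * n) / (α * tau α n) - (-1 / 2 + 1 / (2 * α)) * log 2)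
    (fF (α * tau α n * n) / (α * tau α n) - cA α / tau α n)
  rw [show ∑ m ∈ Finset.Icc 1 n, fL (tau α n * bt α m) - cA α / tau α n -
    (-1 / 2 + 1 / (2 * α)) * log 2 = (∑ m ∈ Finset.Icc 1 n, fL (tau α n * bt α m) -
    fF (α * tau α n * n) / (α * tau α n) - (-1 / 2 + 1 / (2 * α)) * log 2) +
    (fF (α * tau α n * n) / (α * tau α n) - cA α / tau α n) by ring]
  linarith

lemma fG_bound {x : ℝ} (hx : 0 ≤ x) : |fG x - π ^ 2 / 12| ≤ exp (-x) + x * exp (-x) := by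
  have h1 := fF_bound x
  have h2 : x * fL x ≤ x * exp (-x) := by gcongr; exact fL_le_exp x
  have h3 : 0 ≤ x * fL x := mul_nonneg hx (fL_pos x).le
  unfold fG
  rw [abs_le] at h1 ⊢
  constructor <;> linarith

lemma fH_bound {x : ℝ} (hx : 0 ≤ x) :
    |fH x - 2 * (π ^ 2 / 12)| ≤ 2 * (exp (-x) + x * exp (-x)) + x ^ 2 * exp (-x) := by
  have h1 := fG_bound hx
  have h2 : x ^ 2 * fP x ≤ x ^ 2 * exp (-x) := by gcongr; exact fP_le_exp x
  have h3 : 0 ≤ x ^ 2 * fP x := mul_nonneg (sq_nonneg x) (fP_pos x).le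
  unfold fH
  rw [abs_le] at h1 ⊢
  constructor <;> linarith

lemma L2 {α : ℝ} (hα : 1 < α) : ∀ᶠ n : ℕ in atTop,
    |∑ m ∈ Finset.Icc 1 n, (tau α n * bt α m) * fP (tau α n * bt α m) - cA α / tau α n| ≤ 5 := by
  have hτ := tau_tendsto α
  have hlim : Tendsto (fun n : ℕ => 2 * (α * tau α n + 2) +
      ((α * tau α n * n) ^ 0 * exp (-(α * tau α n * n)) / (α * tau α n) +
       (α * tau α n * n) ^ 1 * exp (-(α * tau α n * n)) / (α * tau α n))) atTop
      (𝓝 (2 * (α * 0 + 2) + (0 + 0))) :=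
    (((hτ.const_mul α).add_const 2).const_mul 2).add ((Xpow_tendsto hα 0).add (Xpow_tendsto hα 1))
  filter_upwards [hlim.eventually_lt_const (show _ < (5 : ℝ) by norm_num), eventually_gt_atTop 0]
    with n hn hn0
  have t := tau_pos hα hn0
  have h1 := S2_bound hα t n
  have h2 : |fG (α * tau α n * n) / (α * tau α n) - cA α / tau α n| ≤
      (α * tau α n * n) ^ 0 * exp (-(α * tau α n * n)) / (α * tau α n) +
       (α * tau α n * n) ^ 1 * exp (-(α * tau α n * n)) / (α * tau α n) := by
    have e : cA α / tau α n = (π ^ 2 / 12) / (α * tau α n) := by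
      unfold cA; field_simp
    rw [e, ← sub_div, abs_div, abs_of_pos (show 0 < α * tau α n by positivity), pow_zero, one_mul,
      pow_one, ← add_div]
    gcongr
    exact fG_bound (by positivity)
  have h3 := abs_sub_le (∑ m ∈ Finset.Icc 1 n, (tau α n * bt α m) * fP (tau α n * bt α m))
    (fG (α * tau α n * n) / (α * tau α n)) (cA α / tau α n)
  linarith

lemma L3 {α : ℝ} (hα : 1 < α) : ∀ᶠ n : ℕ in atTop,
    |∑ m ∈ Finset.Icc 1 n, (tau α n * bt α m) ^ 2 * fQ (tau α n * bt α m) -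
      2 * cA α / tau α n| ≤ 17 := by
  have hτ := tau_tendsto α
  have hlim : Tendsto (fun n : ℕ => 8 * (α * tau α n + 2) +
      (2 * ((α * tau α n * n) ^ 0 * exp (-(α * tau α n * n)) / (α * tau α n) +
       (α * tau α n * n) ^ 1 * exp (-(α * tau α n * n)) / (α * tau α n)) +
       (α * tau α n * n) ^ 2 * exp (-(α * tau α n * n)) / (α * tau α n))) atTop
      (𝓝 (8 * (α * 0 + 2) + (2 * (0 + 0) + 0))) :=
    (((hτ.const_mul α).add_const 2).const_mul 8).add
      ((((Xpow_tendsto hα 0).add (Xpow_tendsto hα 1)).const_mul 2).add (Xpow_tendsto hα 2))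
  filter_upwards [hlim.eventually_lt_const (show _ < (17 : ℝ) by norm_num), eventually_gt_atTop 0]
    with n hn hn0
  have t := tau_pos hα hn0
  have h1 := S3_bound hα t n
  have h2 : |fH (α * tau α n * n) / (α * tau α n) - 2 * cA α / tau α n| ≤
      2 * ((α * tau α n * n) ^ 0 * exp (-(α * tau α n * n)) / (α * tau α n) +
       (α * tau α n * n) ^ 1 * exp (-(α * tau α n * n)) / (α * tau α n)) +
       (α * tau α n * n) ^ 2 * exp (-(α * tau α n * n)) / (α * tau α n) := by
    have e : 2 * cA α / tau α n = (2 * (π ^ 2 / 12)) / (α * tau α n) := by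
      unfold cA; field_simp
    rw [e, ← sub_div, abs_div, abs_of_pos (show 0 < α * tau α n by positivity), pow_zero, one_mul,
      pow_one]
    refine (div_le_div_of_nonneg_right (fH_bound (by positivity)) (by positivity)).trans
      (le_of_eq ?_)
    ring
  have h3 := abs_sub_le (∑ m ∈ Finset.Icc 1 n, (tau α n * bt α m) ^ 2 * fQ (tau α n * bt α m))
    (fH (α * tau α n * n) / (α * tau α n)) (2 * cA α / tau α n)
  linarith

/-- Bernoulli characteristic function -/
noncomputable def bern (p y : ℝ) : ℂ := 1 - p + p * Complex.exp (Complex.I * y)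

lemma normSq_bern (p y : ℝ) : ‖bern p y‖ ^ 2 = 1 - 4 * (p * (1 - p)) * sin (y / 2) ^ 2 := by
  have e : bern p y = ((1 - p + p * cos y : ℝ) : ℂ) + ((p * sin y : ℝ) : ℂ) * Complex.I := by
    unfold bern
    rw [mul_comm Complex.I, Complex.exp_mul_I]
    push_cast
    ring
  rw [e, ← Complex.normSq_eq_norm_sq, Complex.normSq_add_mul_I]
  have h1 : cos y = 1 - 2 * sin (y / 2) ^ 2 := by
    have := cos_two_mul (y / 2)
    rw [show 2 * (y / 2) = y by ring] at this
    have h := sin_sq_add_cos_sq (y / 2)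
    linarith
  have h2 := sin_sq_add_cos_sq y
  have h3 : sin y ^ 2 = 1 - cos y ^ 2 := by linarith
  rw [mul_pow, h3, h1]
  ring

lemma norm_bern_le (p y : ℝ) : ‖bern p y‖ ≤ exp (-(2 * (p * (1 - p)) * sin (y / 2) ^ 2)) := by
  refine le_of_sq_le_sq ?_ (exp_pos _).le
  rw [normSq_bern, ← exp_nat_mul]
  have := add_one_le_exp (-(4 * (p * (1 - p)) * sin (y / 2) ^ 2))
  push_cast
  rw [show 2 * -(2 * (p * (1 - p)) * sin (y / 2) ^ 2) = -(4 * (p * (1 - p)) * sin (y / 2) ^ 2) by ring]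
  linarith

lemma norm_bern_le_one {p : ℝ} (h0 : 0 ≤ p) (h1 : p ≤ 1) (y : ℝ) : ‖bern p y‖ ≤ 1 := by
  refine (norm_bern_le p y).trans ?_
  rw [exp_le_one_iff]
  have : 0 ≤ 1 - p := by linarith
  have : 0 ≤ 2 * (p * (1 - p)) * sin (y / 2) ^ 2 := by positivity
  linarith

lemma expI_taylor (y : ℝ) :
    ‖Complex.exp (Complex.I * y) - (1 + Complex.I * y - (y : ℂ) ^ 2 / 2)‖ ≤ 4 * |y| ^ 3 := by
  by_cases h : |y| ≤ 1
  · have hn : ‖Complex.I * y‖ ≤ 1 := by simpa using h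
    have := Complex.exp_bound hn (n := 3) (by norm_num)
    have e : ∑ m ∈ Finset.range 3, (Complex.I * y) ^ m / (m.factorial : ℂ) =
        1 + Complex.I * y - (y : ℂ) ^ 2 / 2 := by
      simp [Finset.sum_range_succ, Nat.factorial, mul_pow]
      ring
    rw [e] at this
    refine this.trans ?_
    have e2 : ‖Complex.I * y‖ = |y| := by simp
    rw [e2]
    have : 0 ≤ |y| ^ 3 := by positivity
    norm_num [Nat.factorial]
    linarith
  · push Not at h
    have e1 : ‖Complex.exp (Complex.I * y)‖ = 1 := by
      rw [mul_comm]; exact Complex.norm_exp_ofReal_mul_I y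
    have e2 : ‖(1 + Complex.I * y - (y : ℂ) ^ 2 / 2)‖ ≤ 1 + |y| + |y| ^ 2 / 2 := by
      refine (norm_sub_le _ _).trans ?_
      gcongr
      · refine (norm_add_le _ _).trans ?_
        simp
      · simp
    refine (norm_sub_le _ _).trans ?_
    rw [e1]
    have h2 : |y| ≤ |y| ^ 3 := by nlinarith
    have h3 : |y| ^ 2 ≤ |y| ^ 3 := by nlinarith [sq_nonneg |y|]
    linarith

lemma exp_neg_taylor {s : ℝ} (hs : 0 ≤ s) : |exp (-s) - 1 + s| ≤ s ^ 2 := by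
  by_cases h : s ≤ 1
  · have := Real.abs_exp_sub_one_sub_id_le (x := -s) (by rw [abs_neg, abs_of_nonneg hs]; exact h)
    rwa [sub_neg_eq_add, neg_sq] at this
  · push Not at h
    have h1 := add_one_le_exp (-s)
    have h2 : exp (-s) ≤ 1 := exp_le_one_iff.2 (by linarith)
    rw [abs_le]
    constructor <;> nlinarith

lemma bern_taylor {p : ℝ} (h0 : 0 ≤ p) (h1 : p ≤ 1) (y : ℝ) :
    ‖bern p y - Complex.exp (Complex.I * (p * y : ℝ)) * (exp (-(p * (1 - p) * y ^ 2 / 2)) : ℝ)‖ ≤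
      p * (9 * |y| ^ 3 + y ^ 4) := by
  have hq : 0 ≤ 1 - p := by linarith
  set s : ℝ := p * (1 - p) * y ^ 2 / 2 with hs
  have s0 : 0 ≤ s := by positivity
  set a : ℂ := Complex.exp (Complex.I * (p * y : ℝ)) with ha
  have na : ‖a‖ = 1 := by
    rw [ha, mul_comm]; exact Complex.norm_exp_ofReal_mul_I _
  have t1 := expI_taylor y
  have t2 := expI_taylor (p * y)
  have t3 := exp_neg_taylor s0
  have t4 : ‖a - 1‖ ≤ |p * y| := by
    have := Real.norm_exp_I_mul_ofReal_sub_one_le (x := p * y)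
    simpa [ha] using this
  rw [← ha] at t2
  have e : bern p y - a * ((exp (-s) : ℝ) : ℂ) =
      p * (Complex.exp (Complex.I * y) - (1 + Complex.I * y - (y : ℂ) ^ 2 / 2)) -
      a * ((exp (-s) - 1 + s : ℝ) : ℂ) -
      (a - (1 + Complex.I * (p * y : ℝ) - ((p * y : ℝ) : ℂ) ^ 2 / 2)) + (a - 1) * (s : ℂ) := by
    unfold bern
    rw [hs]
    push_cast
    ring
  rw [e]
  have n1 : ‖(p : ℂ) * (Complex.exp (Complex.I * y) - (1 + Complex.I * y - (y : ℂ) ^ 2 / 2))‖ ≤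
      p * (4 * |y| ^ 3) := by
    rw [norm_mul, Complex.norm_real, norm_of_nonneg h0]
    gcongr
  have n2 : ‖a * ((exp (-s) - 1 + s : ℝ) : ℂ)‖ ≤ s ^ 2 := by
    rw [norm_mul, na, one_mul, Complex.norm_real]
    exact t3
  have n4 : ‖(a - 1) * (s : ℂ)‖ ≤ |p * y| * s := by
    rw [norm_mul, Complex.norm_real, norm_of_nonneg s0]
    gcongr
  have hsle : s ≤ p * y ^ 2 / 2 := by
    rw [hs]
    have : p * (1 - p) ≤ p := by nlinarith
    gcongr
  have b2 : s ^ 2 ≤ p * y ^ 4 := by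
    have : s ^ 2 ≤ (p * y ^ 2 / 2) ^ 2 := by gcongr
    have h3 : p ^ 2 ≤ p := by nlinarith
    have h4 : p ^ 2 * y ^ 4 ≤ p * y ^ 4 := by gcongr
    have h5 : 0 ≤ p ^ 2 * y ^ 4 := by positivity
    nlinarith
  have hpy : |p * y| = p * |y| := by rw [abs_mul, abs_of_nonneg h0]
  have b3 : 4 * |p * y| ^ 3 ≤ 4 * (p * |y| ^ 3) := by
    rw [hpy, mul_pow]
    have : p ^ 3 ≤ p := by
      have : p ^ 2 ≤ 1 := by nlinarith
      nlinarith
    gcongr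
  have b4 : |p * y| * s ≤ p * |y| ^ 3 := by
    have h6 : s ≤ |y| ^ 2 := by
      rw [sq_abs]; nlinarith [sq_nonneg y]
    rw [hpy]
    calc p * |y| * s ≤ p * |y| * |y| ^ 2 := by gcongr
      _ = _ := by ring
  refine (norm_add_le _ _).trans ?_
  have m1 := norm_sub_le (p * (Complex.exp (Complex.I * y) - (1 + Complex.I * y - (y : ℂ) ^ 2 / 2)) -
      a * ((exp (-s) - 1 + s : ℝ) : ℂ))
      (a - (1 + Complex.I * (p * y : ℝ) - ((p * y : ℝ) : ℂ) ^ 2 / 2))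
  have m2 := norm_sub_le (p * (Complex.exp (Complex.I * y) - (1 + Complex.I * y - (y : ℂ) ^ 2 / 2)))
      (a * ((exp (-s) - 1 + s : ℝ) : ℂ))
  linarith

lemma prod_diff {ι : Type*} (s : Finset ι) (f g : ι → ℂ) (hf : ∀ i ∈ s, ‖f i‖ ≤ 1)
    (hg : ∀ i ∈ s, ‖g i‖ ≤ 1) : ‖∏ i ∈ s, f i - ∏ i ∈ s, g i‖ ≤ ∑ i ∈ s, ‖f i - g i‖ := by
  classical
  induction s using Finset.induction_on with
  | empty => simp
  | insert a s ha ih =>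
    rw [Finset.prod_insert ha, Finset.prod_insert ha, Finset.sum_insert ha]
    have h1 := ih (fun i hi => hf i (Finset.mem_insert_of_mem hi))
      (fun i hi => hg i (Finset.mem_insert_of_mem hi))
    have h2 : ‖∏ i ∈ s, f i‖ ≤ 1 := by
      rw [norm_prod]
      exact Finset.prod_le_one (fun _ _ => norm_nonneg _)
        (fun i hi => hf i (Finset.mem_insert_of_mem hi))
    have h3 := hg a (Finset.mem_insert_self _ _)
    rw [show f a * ∏ i ∈ s, f i - g a * ∏ i ∈ s, g i =
      (f a - g a) * ∏ i ∈ s, f i + g a * (∏ i ∈ s, f i - ∏ i ∈ s, g i) by ring]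
    refine (norm_add_le _ _).trans ?_
    rw [norm_mul, norm_mul]
    have h4 := mul_le_mul_of_nonneg_left h2 (norm_nonneg (f a - g a))
    have h5 := mul_le_mul_of_nonneg_right h3 (norm_nonneg (∏ i ∈ s, f i - ∏ i ∈ s, g i))
    linarith

lemma pow_exp_le (k : ℕ) {x : ℝ} (hx : 0 ≤ x) :
    x ^ k * exp (-x) ≤ (k.factorial * 2 ^ k) * exp (-(x / 2)) := by
  have h := Real.pow_div_factorial_le_exp (x / 2) (by positivity) k
  have hk : (0 : ℝ) < k.factorial := by exact_mod_cast Nat.factorial_pos k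
  rw [div_le_iff₀ hk, div_pow, div_le_iff₀ (by positivity)] at h
  have e : exp (-x) = exp (-(x / 2)) * exp (-(x / 2)) := by rw [← exp_add]; ring_nf
  have e1 : exp (x / 2) * exp (-(x / 2)) = 1 := by rw [← exp_add]; simp
  rw [e, ← mul_assoc]
  refine mul_le_mul_of_nonneg_right ?_ (exp_pos _).le
  calc x ^ k * exp (-(x / 2)) ≤ exp (x / 2) * k.factorial * 2 ^ k * exp (-(x / 2)) := by gcongr
    _ = (k.factorial * 2 ^ k) * (exp (x / 2) * exp (-(x / 2))) := by ring
    _ = _ := by rw [e1, mul_one]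

lemma moment {α t : ℝ} (hα : 1 < α) (ht : 0 < t) (k n : ℕ) :
    ∑ m ∈ Finset.Icc 1 n, fP (t * bt α m) * (t * bt α m) ^ k ≤
      (k.factorial * 2 ^ k) * (1 + 2 / t) := by
  have h : ∀ m ∈ Finset.Icc 1 n, fP (t * bt α m) * (t * bt α m) ^ k ≤
      (k.factorial * 2 ^ k) * exp (-(t / 2 * ((m : ℝ) - 1))) := by
    intro m _
    have hb : (m : ℝ) ≤ bt α m := by exact_mod_cast le_bt hα m
    have hx : 0 ≤ t * bt α m := by positivity
    calc fP (t * bt α m) * (t * bt α m) ^ k ≤ exp (-(t * bt α m)) * (t * bt α m) ^ k := by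
          gcongr; exact fP_le_exp _
      _ = (t * bt α m) ^ k * exp (-(t * bt α m)) := mul_comm _ _
      _ ≤ _ := pow_exp_le k hx
      _ ≤ _ := by
        gcongr
        nlinarith
  refine (Finset.sum_le_sum h).trans ?_
  rw [← Finset.mul_sum]
  gcongr
  refine (geo_sum (by positivity) n).trans (le_of_eq ?_)
  field_simp

/-- tilted characteristic function -/
noncomputable def chi (α : ℝ) (n : ℕ) (θ : ℝ) : ℂ :=
  Complex.exp (-(Complex.I * θ * n)) *
    ∏ m ∈ Finset.Icc 1 n, bern (fP (tau α n * bt α m)) (θ * bt α m)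

/-- scale -/
noncomputable def sc (α : ℝ) (n : ℕ) : ℝ := tau α n * √(tau α n)

/-- gaussian comparison -/
noncomputable def gau (α : ℝ) (n : ℕ) (θ : ℝ) : ℂ :=
  Complex.exp (-(Complex.I * θ * n)) *
    ∏ m ∈ Finset.Icc 1 n, (Complex.exp (Complex.I * (fP (tau α n * bt α m) * (θ * bt α m) : ℝ)) *
      (exp (-(fP (tau α n * bt α m) * (1 - fP (tau α n * bt α m)) * (θ * bt α m) ^ 2 / 2)) : ℝ))

lemma norm_phase (θ : ℝ) (n : ℕ) : ‖Complex.exp (-(Complex.I * θ * n))‖ = 1 := by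
  have := Complex.norm_exp_ofReal_mul_I (-(θ * n))
  rw [← this]; congr 2; push_cast; ring

lemma chi_gau {α : ℝ} (hα : 1 < α) {n : ℕ} (hn : 0 < n) (u : ℝ) :
    ‖chi α n (u * sc α n) - gau α n (u * sc α n)‖ ≤
      9 * |u| ^ 3 * (48 * (√(tau α n) * (tau α n + 2))) +
        u ^ 4 * (384 * (tau α n * (tau α n + 2))) := by
  have t := tau_pos hα hn
  set τ := tau α n with hτ
  set r := √τ with hr
  have r0 : 0 < r := by positivity
  have r2 : r ^ 2 = τ := sq_sqrt t.le
  unfold chi gau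
  rw [← mul_sub, norm_mul, norm_phase, one_mul, ← hτ]
  refine (prod_diff _ _ _ ?_ ?_).trans ?_
  · intro m _
    exact norm_bern_le_one (fP_pos _).le (fP_lt_one _).le _
  · intro m _
    rw [norm_mul, mul_comm Complex.I, Complex.norm_exp_ofReal_mul_I, one_mul, Complex.norm_real,
      norm_of_nonneg (exp_pos _).le, exp_le_one_iff]
    have h1 := fP_pos (τ * bt α m)
    have h2 : 0 ≤ 1 - fP (τ * bt α m) := by linarith [fP_lt_one (τ * bt α m)]
    have : 0 ≤ fP (τ * bt α m) * (1 - fP (τ * bt α m)) * (u * sc α n * bt α m) ^ 2 / 2 := by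
      positivity
    linarith
  · have key : ∀ m ∈ Finset.Icc 1 n, ‖bern (fP (τ * bt α m)) (u * sc α n * bt α m) -
        (Complex.exp (Complex.I * (fP (τ * bt α m) * (u * sc α n * bt α m) : ℝ)) *
      (exp (-(fP (τ * bt α m) * (1 - fP (τ * bt α m)) * (u * sc α n * bt α m) ^ 2 / 2)) : ℝ))‖ ≤
        9 * |u| ^ 3 * r ^ 3 * (fP (τ * bt α m) * (τ * bt α m) ^ 3) +
        u ^ 4 * r ^ 4 * (fP (τ * bt α m) * (τ * bt α m) ^ 4) := by
      intro m _
      refine (bern_taylor (fP_pos _).le (fP_lt_one _).le _).trans (le_of_eq ?_)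
      have e : u * sc α n * bt α m = u * (r * (τ * bt α m)) := by
        unfold sc; rw [← hτ, ← hr]; ring
      have e2 : |u * (r * (τ * bt α m))| = |u| * (r * (τ * bt α m)) := by
        rw [abs_mul, abs_of_nonneg (a := r * (τ * bt α m)) (by positivity)]
      rw [e, e2]
      ring
    refine (Finset.sum_le_sum key).trans ?_
    rw [Finset.sum_add_distrib, ← Finset.mul_sum, ← Finset.mul_sum]
    have m3 := moment hα t 3 n
    have m4 := moment hα t 4 n
    calc _ ≤ 9 * |u| ^ 3 * r ^ 3 * ((Nat.factorial 3 * 2 ^ 3) * (1 + 2 / τ)) +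
        u ^ 4 * r ^ 4 * ((Nat.factorial 4 * 2 ^ 4) * (1 + 2 / τ)) := by
          gcongr
      _ = _ := by
        rw [show r ^ 3 = r * τ by rw [← r2]; ring, show r ^ 4 = τ * τ by rw [← r2]; ring]
        norm_num [Nat.factorial]
        field_simp

lemma gau_eq (α : ℝ) (n : ℕ) (hα : 1 < α) (hn : 0 < n) (u : ℝ) : gau α n (u * sc α n) =
    Complex.exp (Complex.I * (u * √(tau α n) *
      (∑ m ∈ Finset.Icc 1 n, (tau α n * bt α m) * fP (tau α n * bt α m) - cA α / tau α n) : ℝ)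
      - (u ^ 2 / 2 * (tau α n * ∑ m ∈ Finset.Icc 1 n, (tau α n * bt α m) ^ 2 *
        fQ (tau α n * bt α m)) : ℝ)) := by
  have t := tau_pos hα hn
  have r2 : √(tau α n) ^ 2 = tau α n := sq_sqrt t.le
  unfold gau
  rw [Finset.prod_mul_distrib, ← Complex.exp_sum, ← Complex.ofReal_prod, ← Real.exp_sum,
    Complex.ofReal_exp, ← Complex.exp_add, ← Complex.exp_add]
  congr 1
  have e1 : cA α / tau α n = tau α n * n := by
    rw [← tau_sq hα hn]; field_simp
  have e2 : ∑ m ∈ Finset.Icc 1 n, -(fP (tau α n * bt α m) * (1 - fP (tau α n * bt α m)) *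
      (u * sc α n * bt α m) ^ 2 / 2) = -(u ^ 2 / 2 * (tau α n * ∑ m ∈ Finset.Icc 1 n,
      (tau α n * bt α m) ^ 2 * fQ (tau α n * bt α m))) := by
    rw [Finset.mul_sum, Finset.mul_sum, ← Finset.sum_neg_distrib]
    refine Finset.sum_congr rfl fun m _ => ?_
    unfold sc fQ
    rw [show (u * (tau α n * √(tau α n)) * bt α m) ^ 2 =
      u ^ 2 * (tau α n * bt α m) ^ 2 * √(tau α n) ^ 2 by ring, r2]
    ring
  have e3 : ∑ m ∈ Finset.Icc 1 n, Complex.I *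
      ((fP (tau α n * bt α m) * (u * sc α n * bt α m) : ℝ) : ℂ) =
      Complex.I * ((u * √(tau α n) * ∑ m ∈ Finset.Icc 1 n,
        (tau α n * bt α m) * fP (tau α n * bt α m) : ℝ) : ℂ) := by
    rw [← Finset.mul_sum, ← Complex.ofReal_sum, Finset.mul_sum]
    congr 2
    refine Finset.sum_congr rfl fun m _ => ?_
    unfold sc
    ring
  rw [e2, e3, e1]
  unfold sc
  push_cast
  ring

lemma gau_tendsto {α : ℝ} (hα : 1 < α) (u : ℝ) :
    Tendsto (fun n => gau α n (u * sc α n)) atTop (𝓝 ((exp (-cA α * u ^ 2) : ℝ) : ℂ)) := by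
  have hτ := tau_tendsto α
  have hr : Tendsto (fun n => √(tau α n)) atTop (𝓝 0) := by
    have := hτ.sqrt
    rwa [sqrt_zero] at this
  have h1 : Tendsto (fun n => u * √(tau α n) *
      (∑ m ∈ Finset.Icc 1 n, (tau α n * bt α m) * fP (tau α n * bt α m) - cA α / tau α n))
      atTop (𝓝 0) := by
    have hb : Tendsto (fun n => |u| * √(tau α n) * 5) atTop (𝓝 0) := by
      simpa using (hr.const_mul |u|).mul_const 5
    refine squeeze_zero_norm' ?_ hb
    filter_upwards [L2 hα] with n hn
    rw [norm_mul, norm_mul, norm_of_nonneg (sqrt_nonneg (tau α n))]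
    gcongr
    · exact le_refl |u|
    · exact hn
  have h2 : Tendsto (fun n => tau α n * ∑ m ∈ Finset.Icc 1 n, (tau α n * bt α m) ^ 2 *
        fQ (tau α n * bt α m)) atTop (𝓝 (2 * cA α)) := by
    rw [tendsto_iff_norm_sub_tendsto_zero]
    have hb : Tendsto (fun n => tau α n * 17) atTop (𝓝 0) := by
      simpa using hτ.mul_const 17
    refine squeeze_zero' (Eventually.of_forall fun _ => norm_nonneg _) ?_ hb
    filter_upwards [L3 hα, eventually_gt_atTop 0] with n hn hn0
    have t := tau_pos hα hn0
    have e : tau α n * ∑ m ∈ Finset.Icc 1 n, (tau α n * bt α m) ^ 2 *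
        fQ (tau α n * bt α m) - 2 * cA α = tau α n * (∑ m ∈ Finset.Icc 1 n, (tau α n * bt α m) ^ 2 *
        fQ (tau α n * bt α m) - 2 * cA α / tau α n) := by
      field_simp
    rw [e, norm_mul, norm_of_nonneg t.le]
    gcongr
    exact hn
  have h3 := h2.const_mul (u ^ 2 / 2)
  have h4 : Tendsto (fun n => Complex.I * ((u * √(tau α n) *
      (∑ m ∈ Finset.Icc 1 n, (tau α n * bt α m) * fP (tau α n * bt α m) - cA α / tau α n) : ℝ) : ℂ)
      - ((u ^ 2 / 2 * (tau α n * ∑ m ∈ Finset.Icc 1 n, (tau α n * bt α m) ^ 2 *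
        fQ (tau α n * bt α m)) : ℝ) : ℂ)) atTop
      (𝓝 (Complex.I * ((0 : ℝ) : ℂ) - ((u ^ 2 / 2 * (2 * cA α) : ℝ) : ℂ))) :=
    (((Complex.continuous_ofReal.tendsto _).comp h1).const_mul Complex.I).sub
      ((Complex.continuous_ofReal.tendsto _).comp h3)
  have h5 := (Complex.continuous_exp.tendsto _).comp h4
  have e : Complex.exp (Complex.I * ((0 : ℝ) : ℂ) - ((u ^ 2 / 2 * (2 * cA α) : ℝ) : ℂ)) =
      ((exp (-cA α * u ^ 2) : ℝ) : ℂ) := by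
    rw [Complex.ofReal_exp]; congr 1; push_cast; ring
  rw [e] at h5
  refine h5.congr' ?_
  filter_upwards [eventually_gt_atTop 0] with n hn
  rw [gau_eq α n hα hn u]
  rfl

lemma chi_tendsto {α : ℝ} (hα : 1 < α) (u : ℝ) :
    Tendsto (fun n => chi α n (u * sc α n)) atTop (𝓝 ((exp (-cA α * u ^ 2) : ℝ) : ℂ)) := by
  have hτ := tau_tendsto α
  have hr : Tendsto (fun n => √(tau α n)) atTop (𝓝 0) := by
    have := hτ.sqrt
    rwa [sqrt_zero] at this
  have h0 : Tendsto (fun n => chi α n (u * sc α n) - gau α n (u * sc α n)) atTop (𝓝 0) := by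
    have hb : Tendsto (fun n => 9 * |u| ^ 3 * (48 * (√(tau α n) * (tau α n + 2))) +
        u ^ 4 * (384 * (tau α n * (tau α n + 2)))) atTop
        (𝓝 (9 * |u| ^ 3 * (48 * (0 * (0 + 2))) + u ^ 4 * (384 * (0 * (0 + 2))))) :=
      (((hr.mul (hτ.add_const 2)).const_mul 48).const_mul _).add
        (((hτ.mul (hτ.add_const 2)).const_mul 384).const_mul _)
    rw [show 9 * |u| ^ 3 * (48 * (0 * (0 + 2))) + u ^ 4 * (384 * (0 * (0 + 2))) = 0 by ring] at hb
    refine squeeze_zero_norm' ?_ hb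
    filter_upwards [eventually_gt_atTop 0] with n hn using chi_gau hα hn u
  simpa using h0.add (gau_tendsto hα u)

lemma chi_norm_le {α : ℝ} (hα : 1 < α) {n : ℕ} (hn : 0 < n) (M : ℕ) (hM : M ≤ n)
    (hMt : tau α n * M ≤ 1) (θ : ℝ) :
    ‖chi α n θ‖ ≤ exp (-(exp (-α) / 2 * sinS α θ M)) := by
  have t := tau_pos hα hn
  unfold chi
  rw [norm_mul, norm_phase, one_mul, norm_prod]
  have h1 : ∏ m ∈ Finset.Icc 1 n, ‖bern (fP (tau α n * bt α m)) (θ * bt α m)‖ ≤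
      ∏ m ∈ Finset.Icc 1 n, exp (-(2 * fQ (tau α n * bt α m) * sin (θ * bt α m / 2) ^ 2)) :=
    Finset.prod_le_prod (fun _ _ => norm_nonneg _) (fun m _ => norm_bern_le _ _)
  refine h1.trans ?_
  rw [← Real.exp_sum, Finset.sum_neg_distrib]
  gcongr
  unfold sinS
  rw [Finset.mul_sum]
  calc _ ≤ ∑ m ∈ Finset.Icc 1 M, 2 * fQ (tau α n * bt α m) * sin (θ * bt α m / 2) ^ 2 := by
        refine Finset.sum_le_sum fun m hm => ?_
        rw [Finset.mem_Icc] at hm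
        gcongr
        have hb := bt_le hα m
        have hx : 0 ≤ tau α n * bt α m := by positivity
        have h2 := fQ_ge hx
        have hmM : (m : ℝ) ≤ M := by exact_mod_cast hm.2
        have h3 : tau α n * bt α m ≤ α := by
          calc tau α n * bt α m ≤ tau α n * (α * m) := by gcongr
            _ ≤ tau α n * (α * M) := by gcongr
            _ = α * (tau α n * M) := by ring
            _ ≤ α * 1 := by gcongr
            _ = α := mul_one α
        have h4 : exp (-α) ≤ exp (-(tau α n * bt α m)) := by gcongr
        linarith
    _ ≤ _ := by
        refine Finset.sum_le_sum_of_subset_of_nonneg (Finset.Icc_subset_Icc_right hM) ?_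
        intro m _ _
        have := fQ_pos (tau α n * bt α m)
        positivity

lemma chi_dom {α : ℝ} (hα : 1 < α) (hirr : Irrational α) : ∃ K > 0, ∀ᶠ n : ℕ in atTop, ∀ u : ℝ,
    |u * sc α n| ≤ π → ‖chi α n (u * sc α n)‖ ≤ K * (1 + u ^ 2)⁻¹ := by
  obtain ⟨c, hc, M0, hS⟩ := sinS_main hα hirr
  set d : ℝ := exp (-α) / 2 * (c / 8) with hd
  have d0 : 0 < d := by positivity
  refine ⟨1 + 1 / d + 6 * (1 + π ^ 2) / d ^ 3, by positivity, ?_⟩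
  have hτ := tau_tendsto α
  have hA := cA_pos hα
  have hM0 : (0 : ℝ) < 1 / (M0 + 1) := by positivity
  filter_upwards [eventually_gt_atTop 0, hτ.eventually_lt_const hM0,
    hτ.eventually_lt_const hA, hτ.eventually_lt_const (zero_lt_one)] with n hn ht1 ht2 ht3
  intro u hu
  have t := tau_pos hα hn
  have hsq := tau_sq hα hn
  have r2 : √(tau α n) ^ 2 = tau α n := sq_sqrt t.le
  have esc : (u * sc α n) ^ 2 = u ^ 2 * tau α n ^ 3 := by
    unfold sc
    rw [show (u * (tau α n * √(tau α n))) ^ 2 = u ^ 2 * tau α n ^ 2 * √(tau α n) ^ 2 by ring, r2]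
    ring
  have hu2 : u ^ 2 * tau α n ^ 3 ≤ π ^ 2 := by
    rw [← esc, ← sq_abs]
    gcongr
  set τ := tau α n with hτd
  set M := ⌊1 / τ⌋₊ with hM
  have x1 : 1 < 1 / τ := by rw [lt_div_iff₀ t]; linarith
  have M1 : (M : ℝ) ≤ 1 / τ := Nat.floor_le (by positivity)
  have M2 : 1 / τ < M + 1 := Nat.lt_floor_add_one _
  have M3 : (1 : ℝ) ≤ M := by
    have : 1 ≤ M := Nat.le_floor (by push_cast; exact x1.le)
    exact_mod_cast this
  have M4 : 1 / (2 * τ) ≤ M := by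
    have : 1 / (2 * τ) = (1 / τ) / 2 := by field_simp
    rw [this]; linarith
  have hMn : M ≤ n := by
    have : (M : ℝ) ≤ n := by
      refine M1.trans ?_
      rw [div_le_iff₀ t]
      have : τ * 1 ≤ τ * (τ * n) := by
        calc τ * 1 ≤ cA α := by linarith
          _ = τ * (τ * n) := by rw [← hsq]; ring
      have := le_of_mul_le_mul_left this t
      linarith
    exact_mod_cast this
  have hMM : M0 ≤ M := by
    refine Nat.le_floor ?_
    rw [le_div_iff₀ t]
    rw [lt_div_iff₀ (by positivity)] at ht1
    nlinarith
  have hMt : τ * M ≤ 1 := by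
    rw [le_div_iff₀ t] at M1; linarith
  have h1 := chi_norm_le hα hn M hMn hMt (u * sc α n)
  have h2 := hS M hMM (u * sc α n) hu
  have h3 : min (1 / τ) (u ^ 2) / 8 ≤ min (M : ℝ) ((u * sc α n) ^ 2 * M ^ 3) := by
    refine le_min ?_ ?_
    · have := min_le_left (1 / τ) (u ^ 2)
      have e : 1 / (2 * τ) = (1 / τ) / 2 := by field_simp
      linarith
    · have := min_le_right (1 / τ) (u ^ 2)
      rw [esc]
      calc min (1 / τ) (u ^ 2) / 8 ≤ u ^ 2 / 8 := by gcongr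
        _ = u ^ 2 * τ ^ 3 * (1 / (2 * τ)) ^ 3 := by field_simp; norm_num
        _ ≤ _ := by gcongr
  have h4 : ‖chi α n (u * sc α n)‖ ≤ exp (-(d * min (1 / τ) (u ^ 2))) := by
    refine h1.trans ?_
    rw [exp_le_exp, neg_le_neg_iff]
    calc d * min (1 / τ) (u ^ 2) = exp (-α) / 2 * (c * (min (1 / τ) (u ^ 2) / 8)) := by
          rw [hd]; ring
      _ ≤ exp (-α) / 2 * (c * min (M : ℝ) ((u * sc α n) ^ 2 * M ^ 3)) := by gcongr
      _ ≤ _ := by gcongr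
  refine h4.trans ?_
  rw [← div_eq_mul_inv, le_div_iff₀ (by positivity)]
  have p1 : 0 < 1 / d := by positivity
  have p2 : 0 < 6 * (1 + π ^ 2) / d ^ 3 := by positivity
  rcases le_total (1 / τ) (u ^ 2) with h | h
  · rw [min_eq_left h, exp_neg, inv_mul_le_iff₀ (exp_pos _)]
    have h5 := Real.pow_div_factorial_le_exp (d * (1 / τ)) (by positivity) 3
    norm_num [Nat.factorial] at h5
    have h6 : 1 + u ^ 2 ≤ (1 + π ^ 2) / τ ^ 3 := by
      rw [le_div_iff₀ (by positivity)]
      have : τ ^ 3 ≤ 1 := pow_le_one₀ t.le ht3.le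
      linarith
    calc 1 + u ^ 2 ≤ (1 + π ^ 2) / τ ^ 3 := h6
      _ = (d * τ⁻¹) ^ 3 / 6 * (6 * (1 + π ^ 2) / d ^ 3) := by field_simp
      _ ≤ exp (d * τ⁻¹) * (6 * (1 + π ^ 2) / d ^ 3) := by gcongr
      _ ≤ _ := by
        rw [one_div τ]
        gcongr
        linarith
  · rw [min_eq_right h, exp_neg, inv_mul_le_iff₀ (exp_pos _)]
    have h5 := add_one_le_exp (d * u ^ 2)
    calc 1 + u ^ 2 ≤ (d * u ^ 2 + 1) * (1 + 1 / d) := by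
          have : (d * u ^ 2 + 1) * (1 + 1 / d) = 1 + u ^ 2 + d * u ^ 2 + 1 / d := by
            field_simp; ring
          have : 0 ≤ d * u ^ 2 := by positivity
          linarith
      _ ≤ exp (d * u ^ 2) * (1 + 1 / d) := by gcongr
      _ ≤ _ := mul_le_mul_of_nonneg_left (by linarith) (exp_pos _).le

lemma chi_cont (α : ℝ) (n : ℕ) : Continuous (chi α n) := by
  unfold chi bern
  fun_prop

lemma sc_pos {α : ℝ} (hα : 1 < α) {n : ℕ} (hn : 0 < n) : 0 < sc α n := by
  have := tau_pos hα hn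
  unfold sc; positivity

lemma sc_tendsto (α : ℝ) : Tendsto (sc α) atTop (𝓝 0) := by
  have hτ := tau_tendsto α
  have := hτ.mul hτ.sqrt
  rw [zero_mul] at this
  exact this

lemma int_tendsto {α : ℝ} (hα : 1 < α) (hirr : Irrational α) :
    Tendsto (fun n => ∫ u in (-(π / sc α n))..(π / sc α n), chi α n (u * sc α n)) atTop
      (𝓝 ((√(π / cA α) : ℝ) : ℂ)) := by
  obtain ⟨K, hK, hdom⟩ := chi_dom hα hirr
  rw [← integral_gaussian, ← integral_complex_ofReal]
  have h : Tendsto (fun n => ∫ u, (Set.Ioc (-(π / sc α n)) (π / sc α n)).indicator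
      (fun u => chi α n (u * sc α n)) u) atTop
      (𝓝 (∫ u : ℝ, ((exp (-cA α * u ^ 2) : ℝ) : ℂ))) := by
    refine MeasureTheory.tendsto_integral_filter_of_dominated_convergence
      (fun u => K * (1 + u ^ 2)⁻¹) ?_ ?_ ?_ ?_
    · refine Eventually.of_forall fun n => ?_
      refine MeasureTheory.AEStronglyMeasurable.indicator ?_ measurableSet_Ioc
      exact ((chi_cont α n).comp (by fun_prop)).aestronglyMeasurable
    · filter_upwards [hdom, eventually_gt_atTop 0] with n hn hn0
      refine Eventually.of_forall fun u => ?_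
      have s := sc_pos hα hn0
      by_cases hu : u ∈ Set.Ioc (-(π / sc α n)) (π / sc α n)
      · rw [Set.indicator_of_mem hu]
        refine hn u ?_
        rw [abs_mul, abs_of_pos s, ← le_div_iff₀ s, abs_le]
        exact ⟨hu.1.le, hu.2⟩
      · rw [Set.indicator_of_notMem hu, norm_zero]
        positivity
    · exact integrable_inv_one_add_sq.const_mul K
    · refine Eventually.of_forall fun u => ?_
      refine (chi_tendsto hα u).congr' ?_
      have hb : Tendsto (fun n => |u| * sc α n) atTop (𝓝 0) := by
        simpa using (sc_tendsto α).const_mul |u|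
      filter_upwards [hb.eventually_lt_const pi_pos, eventually_gt_atTop 0] with n hn hn0
      have s := sc_pos hα hn0
      rw [← lt_div_iff₀ s, abs_lt] at hn
      rw [Set.indicator_of_mem (show u ∈ Set.Ioc _ _ from ⟨hn.1, hn.2.le⟩)]
  refine h.congr' ?_
  filter_upwards [eventually_gt_atTop 0] with n hn0
  have s := sc_pos hα hn0
  have : 0 < π / sc α n := by positivity
  rw [intervalIntegral.integral_of_le (by linarith), MeasureTheory.integral_indicator
    measurableSet_Ioc]

lemma factor_eq (x θ b : ℝ) : (1 + Complex.exp (-(x : ℂ) + Complex.I * θ * b)) =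
    ((exp (fL x) : ℝ) : ℂ) * bern (fP x) (θ * b) := by
  have h0 : 0 < exp (-x) := exp_pos _
  have e1 : exp (fL x) = 1 + exp (-x) := by
    unfold fL; rw [exp_log (by positivity)]
  have e2 : exp (fL x) * fP x = exp (-x) := by
    rw [e1, fP_eq]; field_simp
  have e3 : exp (fL x) * (1 - fP x) = 1 := by rw [mul_sub, e2, e1]; ring
  unfold bern
  rw [mul_add, ← mul_assoc, ← Complex.ofReal_mul, e2, Complex.exp_add]
  have e4 : ((exp (fL x) : ℝ) : ℂ) * (1 - (fP x : ℂ)) = 1 := by exact_mod_cast congrArg ((↑) : ℝ → ℂ) e3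
  rw [e4]
  push_cast
  ring_nf

lemma main_id {α : ℝ} (hα : 1 < α) {n : ℕ} (hn : 0 < n) :
    ∫ u in (-(π / sc α n))..(π / sc α n), chi α n (u * sc α n) =
      ((2 * π * beattyDistinctPartitions α n * exp (-(tau α n * n)) /
        (sc α n * exp (∑ m ∈ Finset.Icc 1 n, fL (tau α n * bt α m))) : ℝ) : ℂ) := by
  have s := sc_pos hα hn
  have h1 := fourier_rep hα n (tau α n)
  have h2 := intervalIntegral.smul_integral_comp_mul_right (a := -(π / sc α n)) (b := π / sc α n)
    (chi α n) (sc α n)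
  rw [show -(π / sc α n) * sc α n = -π by field_simp, show π / sc α n * sc α n = π by field_simp]
    at h2
  have h3 : ∀ θ : ℝ, Complex.exp (-(Complex.I * θ * n)) * ∏ m ∈ Finset.Icc 1 n,
      (1 + Complex.exp ((-(tau α n : ℂ) + Complex.I * θ) * bt α m)) =
      ((exp (∑ m ∈ Finset.Icc 1 n, fL (tau α n * bt α m)) : ℝ) : ℂ) * chi α n θ := by
    intro θ
    unfold chi
    rw [Real.exp_sum, Complex.ofReal_prod, mul_left_comm, ← Finset.prod_mul_distrib]
    congr 1
    refine Finset.prod_congr rfl fun m _ => ?_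
    rw [← factor_eq]
    congr 2
    push_cast
    ring
  simp_rw [h3] at h1
  rw [intervalIntegral.integral_const_mul, ← h2, Complex.real_smul] at h1
  have n1 : (sc α n : ℂ) ≠ 0 := by exact_mod_cast s.ne'
  have n2 : ((exp (∑ m ∈ Finset.Icc 1 n, fL (tau α n * bt α m)) : ℝ) : ℂ) ≠ 0 := by
    exact_mod_cast (exp_pos _).ne'
  rw [Complex.ofReal_div, eq_div_iff (by rw [Complex.ofReal_mul]; exact mul_ne_zero n1 n2)]
  rw [Complex.ofReal_mul, mul_comm, mul_comm (sc α n : ℂ), mul_assoc, h1]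
  push_cast
  rfl

lemma Jr_tendsto {α : ℝ} (hα : 1 < α) (hirr : Irrational α) :
    Tendsto (fun n => 2 * π * beattyDistinctPartitions α n * exp (-(tau α n * n)) /
        (sc α n * exp (∑ m ∈ Finset.Icc 1 n, fL (tau α n * bt α m)))) atTop
      (𝓝 (√(π / cA α))) := by
  have h := (Complex.continuous_re.tendsto _).comp (int_tendsto hα hirr)
  rw [Complex.ofReal_re] at h
  refine h.congr' ?_
  filter_upwards [eventually_gt_atTop 0] with n hn
  simp only [Function.comp]
  rw [main_id hα hn, Complex.ofReal_re]

lemma sc_rpow {α : ℝ} (hα : 1 < α) {n : ℕ} (hn : 0 < n) :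
    sc α n * (n : ℝ) ^ ((3 : ℝ) / 4) = cA α ^ ((3 : ℝ) / 4) := by
  have hA := cA_pos hα
  have hn' : (0 : ℝ) < n := by exact_mod_cast hn
  have hx : 0 < cA α / n := by positivity
  unfold sc tau
  rw [sqrt_eq_rpow, sqrt_eq_rpow, ← rpow_mul hx.le, ← rpow_add hx,
    show (1 : ℝ) / 2 + 1 / 2 * (1 / 2) = 3 / 4 by norm_num, ← mul_rpow hx.le hn'.le]
  congr 1
  field_simp

lemma main_exp {α : ℝ} (hα : 1 < α) {n : ℕ} (hn : 0 < n) :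
    π * √(n / (3 * α)) = 2 * cA α / tau α n := by
  have t := tau_pos hα hn
  have hA := cA_pos hα
  have h := tau_sq hα hn
  have : √(n / (3 * α)) = 2 * cA α / (π * tau α n) := by
    rw [Real.sqrt_eq_iff_mul_self_eq (by positivity) (by positivity)]
    have e : (n : ℝ) = cA α / tau α n ^ 2 := by rw [← h]; field_simp
    rw [e]
    unfold cA
    field_simp
    norm_num
  rw [this]
  field_simp

lemma const_id {α : ℝ} (hα : 1 < α) :
    √(π / cA α) * exp ((-1 / 2 + 1 / (2 * α)) * log 2) *
      (cA α ^ ((3 : ℝ) / 4) * ((2 : ℝ) ^ (2 - 1 / (2 * α)) * (3 * α) ^ ((1 : ℝ) / 4)) / (2 * π)) = 1 := by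
  have hA := cA_pos hα
  have h1 : exp ((-1 / 2 + 1 / (2 * α)) * log 2) * (2 : ℝ) ^ (2 - 1 / (2 * α)) =
      (2 : ℝ) ^ ((1 : ℝ) / 2) * 2 := by
    rw [rpow_def_of_pos (by norm_num), rpow_def_of_pos (by norm_num), ← exp_add]
    have e2 : exp (log 2 * (1 / 2)) * 2 = exp (log 2 * (1 / 2)) * exp (log 2) := by
      rw [exp_log (show (0 : ℝ) < 2 by norm_num)]
    rw [e2, ← exp_add]
    congr 1
    ring
  have h2 : √(π / cA α) * cA α ^ ((3 : ℝ) / 4) = π ^ ((1 : ℝ) / 2) * cA α ^ ((1 : ℝ) / 4) := by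
    rw [sqrt_eq_rpow, div_rpow pi_pos.le hA.le, div_mul_eq_mul_div, mul_div_assoc, ← rpow_sub hA]
    norm_num
  have h3 : cA α ^ ((1 : ℝ) / 4) * (3 * α) ^ ((1 : ℝ) / 4) = π ^ ((1 : ℝ) / 2) / 2 ^ ((1 : ℝ) / 2) := by
    rw [← mul_rpow hA.le (by positivity), ← div_rpow pi_pos.le (by norm_num)]
    have : cA α * (3 * α) = (π / 2) ^ (2 : ℝ) := by
      unfold cA; rw [rpow_two]; field_simp; norm_num
    rw [this, ← rpow_mul (by positivity)]
    norm_num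
  have h4 : π ^ ((1 : ℝ) / 2) * π ^ ((1 : ℝ) / 2) = π := by
    rw [← rpow_add pi_pos]; norm_num
  have h5 : (0 : ℝ) < 2 ^ ((1 : ℝ) / 2) := by positivity
  calc _ = (√(π / cA α) * cA α ^ ((3 : ℝ) / 4)) *
        (exp ((-1 / 2 + 1 / (2 * α)) * log 2) * (2 : ℝ) ^ (2 - 1 / (2 * α))) *
        (3 * α) ^ ((1 : ℝ) / 4) / (2 * π) := by ring
    _ = π ^ ((1 : ℝ) / 2) * (cA α ^ ((1 : ℝ) / 4) * (3 * α) ^ ((1 : ℝ) / 4)) *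
        ((2 : ℝ) ^ ((1 : ℝ) / 2) * 2) / (2 * π) := by rw [h1, h2]; ring
    _ = (π ^ ((1 : ℝ) / 2) * π ^ ((1 : ℝ) / 2)) / π := by
        rw [h3]; field_simp
    _ = 1 := by rw [h4]; field_simp

theorem stmt0 (α : ℝ) (hα : 1 < α) (hirr : Irrational α) :
    Tendsto (fun n : ℕ =>
        (beattyDistinctPartitions α n : ℝ) /
          (Real.exp (π * Real.sqrt (n / (3 * α))) /
            ((2 : ℝ) ^ (2 - 1 / (2 * α)) * (3 * α) ^ ((1 : ℝ) / 4) *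
              (n : ℝ) ^ ((3 : ℝ) / 4))))
      atTop (𝓝 1) := by
  have h1 := Jr_tendsto hα hirr
  have h2 := (continuous_exp.tendsto _).comp (L1 hα hirr)
  have h3 := (h1.mul h2).mul_const
    (cA α ^ ((3 : ℝ) / 4) * ((2 : ℝ) ^ (2 - 1 / (2 * α)) * (3 * α) ^ ((1 : ℝ) / 4)) / (2 * π))
  rw [const_id hα] at h3
  refine h3.congr' ?_
  filter_upwards [eventually_gt_atTop 0] with n hn
  have t := tau_pos hα hn
  have s := sc_pos hα hn
  simp only [Function.comp]
  rw [main_exp hα hn, ← sc_rpow hα hn]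
  have e1 : tau α n * n = cA α / tau α n := by
    rw [← tau_sq hα hn]; field_simp
  rw [e1, exp_sub, exp_neg, show 2 * cA α / tau α n = cA α / tau α n + cA α / tau α n by ring, exp_add]
  have p1 := exp_pos (cA α / tau α n)
  have p2 := exp_pos (∑ m ∈ Finset.Icc 1 n, fL (tau α n * bt α m))
  set E := exp (cA α / tau α n)
  set F := exp (∑ m ∈ Finset.Icc 1 n, fL (tau α n * bt α m))
  field_simp
end

section
/- As t → 0⁺, t·D(t) = γ − log t + O(t^{1/2}), the derivative satisfies (t·D(t))' = −t^{−1} + O(t^{−1/2}), and the second derivative satisfies (t·D(t))'' = O(t^{−2}). -/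
open Filter Topology Real Asymptotics

/-- `D(t) = ∑_{n ≥ 1} 1/(e^{nt} - 1)`. -/
noncomputable def DSum (t : ℝ) : ℝ :=
  ∑' n : ℕ, 1 / (Real.exp ((n + 1) * t) - 1)

namespace DS

noncomputable def k (x : ℝ) : ℝ := x / (exp x - 1)
noncomputable def k1 (x : ℝ) : ℝ := (exp x - 1 - x * exp x) / (exp x - 1) ^ 2
noncomputable def k2 (x : ℝ) : ℝ := exp x * ((x - 2) * exp x + x + 2) / (exp x - 1) ^ 3

lemma em1 {x : ℝ} (hx : 0 < x) : 0 < exp x - 1 := by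
  have := Real.add_one_lt_exp hx.ne'
  linarith

lemma hk {x : ℝ} (hx : 0 < x) : HasDerivAt k (k1 x) x := by
  have h := em1 hx
  have := (hasDerivAt_id x).div ((Real.hasDerivAt_exp x).sub_const 1) h.ne'
  convert! this using 1
  simp [k1]

lemma hk1 {x : ℝ} (hx : 0 < x) : HasDerivAt k1 (k2 x) x := by
  have h := em1 hx
  have := (((Real.hasDerivAt_exp x).sub_const 1).sub ((hasDerivAt_id x).mul (Real.hasDerivAt_exp x))).div
    (((Real.hasDerivAt_exp x).sub_const 1).pow 2) (pow_ne_zero 2 h.ne')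
  convert! this using 1
  simp [k2]
  field_simp
  ring

/-- monotonicity helper -/
lemma nonneg_of (g g' : ℝ → ℝ) (h0 : g 0 = 0) (hd : ∀ x, HasDerivAt g (g' x) x)
    (hn : ∀ x, 0 ≤ x → 0 ≤ g' x) {x : ℝ} (hx : 0 ≤ x) : 0 ≤ g x := by
  have : MonotoneOn g (Set.Ici 0) := by
    apply monotoneOn_of_deriv_nonneg (convex_Ici 0)
    · exact fun y _ => (hd y).continuousAt.continuousWithinAt
    · exact fun y _ => (hd y).differentiableAt.differentiableWithinAt
    · intro y hy
      rw [(hd y).deriv]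
      rw [interior_Ici] at hy
      exact hn y (le_of_lt hy)
  have := this (Set.mem_Ici.2 le_rfl) (Set.mem_Ici.2 hx) hx
  linarith

lemma N1 {x : ℝ} (hx : 0 ≤ x) : 0 ≤ (x - 1) * exp x + 1 := by
  apply nonneg_of (fun x => (x - 1) * exp x + 1) (fun x => x * exp x) (by simp) _ _ hx
  · intro x
    have := (((hasDerivAt_id x).sub_const 1).mul (Real.hasDerivAt_exp x)).add_const 1
    convert! this using 1
    simp; ring
  · intro x hx; positivity

lemma N0 {x : ℝ} (hx : 0 ≤ x) : 0 ≤ (x - 2) * exp x + x + 2 := by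
  apply nonneg_of (fun x => (x - 2) * exp x + x + 2) (fun x => (x - 1) * exp x + 1) (by simp) _ _ hx
  · intro x
    have := ((((hasDerivAt_id x).sub_const 2).mul (Real.hasDerivAt_exp x)).add (hasDerivAt_id x)).add_const 2
    convert! this using 1
    simp; ring
  · intro x hx; exact N1 hx

lemma N1u {x : ℝ} (hx : 0 ≤ x) : 0 ≤ x ^ 2 * exp x - ((x - 1) * exp x + 1) := by
  apply nonneg_of (fun x => x ^ 2 * exp x - ((x - 1) * exp x + 1)) (fun x => (x ^ 2 + x) * exp x) (by simp) _ _ hx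
  · intro x
    have := (((hasDerivAt_id x).pow 2).mul (Real.hasDerivAt_exp x)).sub
      ((((hasDerivAt_id x).sub_const 1).mul (Real.hasDerivAt_exp x)).add_const 1)
    convert! this using 1
    simp; ring
  · intro x hx; positivity

lemma N0u {x : ℝ} (hx : 0 ≤ x) : 0 ≤ x ^ 3 * exp x - ((x - 2) * exp x + x + 2) := by
  apply nonneg_of (fun x => x ^ 3 * exp x - ((x - 2) * exp x + x + 2))
    (fun x => (x ^ 3 + 2 * x ^ 2) * exp x + (x ^ 2 * exp x - ((x - 1) * exp x + 1))) (by simp) _ _ hx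
  · intro x
    have := (((hasDerivAt_id x).pow 3).mul (Real.hasDerivAt_exp x)).sub
      (((((hasDerivAt_id x).sub_const 2).mul (Real.hasDerivAt_exp x)).add (hasDerivAt_id x)).add_const 2)
    convert! this using 1
    simp; ring
  · intro x hx
    have := N1u hx
    positivity

lemma k2_nonneg {x : ℝ} (hx : 0 < x) : 0 ≤ k2 x := by
  have := N0 hx.le
  have := em1 hx
  unfold k2; positivity

/-- `x ≤ e^{x/2} - e^{-x/2}`. -/
lemma key {x : ℝ} (hx : 0 ≤ x) : x ≤ exp (x/2) - exp (-(x/2)) := by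
  have := Real.self_le_sinh_iff.2 (show 0 ≤ x/2 by linarith)
  rw [Real.sinh_eq] at this
  linarith

lemma key2 {x : ℝ} (hx : 0 ≤ x) : x * exp (x/2) ≤ exp x - 1 := by
  have := mul_le_mul_of_nonneg_right (key hx) (exp_pos (x/2)).le
  rw [sub_mul, ← exp_add, ← exp_add] at this
  simpa using this

lemma key3 {x : ℝ} (hx : 0 ≤ x) : x ^ 2 * exp x ≤ (exp x - 1) ^ 2 := by
  have h := pow_le_pow_left₀ (by positivity) (key2 hx) 2
  rw [mul_pow, ← exp_nat_mul] at h
  have e : ((2:ℕ):ℝ) * (x/2) = x := by push_cast; ring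
  rwa [e] at h

lemma k_le {x : ℝ} (hx : 0 < x) : k x ≤ exp (-(x/2)) := by
  unfold k
  rw [div_le_iff₀ (em1 hx)]
  have := mul_le_mul_of_nonneg_left (key2 hx.le) (exp_pos (-(x/2))).le
  calc x = exp (-(x/2)) * (x * exp (x/2)) := by
        rw [mul_left_comm, ← exp_add]; simp
    _ ≤ _ := this

lemma k2_le {x : ℝ} (hx : 0 < x) : k2 x ≤ 16 * exp (-(x/2)) := by
  have h := em1 hx
  have hE := exp_pos x
  rcases le_total x 1 with h1 | h1
  · have ha : k2 x ≤ exp x ^ 2 * (x ^ 3 / (exp x - 1) ^ 3) := by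
      unfold k2
      rw [← mul_div_assoc]
      have := N0u hx.le
      apply div_le_div_of_nonneg_right _ (by positivity)
      calc _ ≤ exp x * (x ^ 3 * exp x) := by gcongr; linarith
        _ = _ := by ring
    have hb : x ^ 3 / (exp x - 1) ^ 3 ≤ exp (-(x/2)) ^ 3 := by
      rw [← div_pow]
      exact pow_le_pow_left₀ (div_nonneg hx.le h.le) (k_le hx) 3
    have hc : exp x ^ 2 * exp (-(x/2)) ^ 3 = exp x * exp (-(x/2)) := by
      rw [← exp_nat_mul, ← exp_nat_mul, ← exp_add, ← exp_add]; congr 1; push_cast; ring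
    have hd : exp x ≤ 16 := by
      have := Real.exp_one_lt_d9
      have := exp_le_exp.2 h1
      linarith
    calc k2 x ≤ _ := ha
      _ ≤ exp x ^ 2 * exp (-(x/2)) ^ 3 := by gcongr
      _ = exp x * exp (-(x/2)) := hc
      _ ≤ _ := by gcongr
  · have h2 : exp x ≤ 2 * (exp x - 1) := by
      have := Real.add_one_le_exp x
      linarith
    have ha : k2 x ≤ exp x * (x * exp x) / (exp x / 2) ^ 3 := by
      unfold k2
      have := Real.add_one_le_exp x
      have := N0 hx.le
      gcongr
      · nlinarith
      · linarith
    have hb : exp x * (x * exp x) / (exp x / 2) ^ 3 = 16 * ((x/2) * exp (-x)) := by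
      rw [exp_neg]; field_simp; ring
    have hc : (x/2) * exp (-x) ≤ exp (x/2) * exp (-x) := by
      have := Real.add_one_le_exp (x/2)
      gcongr; linarith
    rw [← exp_add] at hc
    have : x/2 + -x = -(x/2) := by ring
    rw [this] at hc
    linarith

lemma k1_nonpos {x : ℝ} (hx : 0 < x) : k1 x ≤ 0 := by
  unfold k1
  apply div_nonpos_of_nonpos_of_nonneg _ (by positivity)
  have := N1 hx.le
  linarith

lemma k1_mono : MonotoneOn k1 (Set.Ioi 0) := by
  apply monotoneOn_of_deriv_nonneg (convex_Ioi 0)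
  · exact fun y hy => (hk1 hy).continuousAt.continuousWithinAt
  · rw [interior_Ioi]; exact fun y hy => (hk1 hy).differentiableAt.differentiableWithinAt
  · rw [interior_Ioi]; intro y hy
    rw [(hk1 hy).deriv]; exact k2_nonneg hy

lemma k1_bd {a x : ℝ} (ha : 0 < a) (hx : a ≤ x) : |k1 x| ≤ (1 - exp (-a))⁻¹ * exp (-(x/2)) := by
  have hx0 : 0 < x := by linarith
  have h := em1 hx0
  have h1 : 0 < 1 - exp (-a) := by
    have : exp (-a) < 1 := by rw [exp_lt_one_iff]; linarith
    linarith
  have h2 : exp x / (exp x - 1) ≤ (1 - exp (-a))⁻¹ := by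
    rw [div_le_iff₀ h, inv_mul_eq_div, le_div_iff₀ h1]
    have : 1 ≤ exp x * exp (-a) := by
      rw [← exp_add]; apply one_le_exp; linarith
    linarith
  rw [abs_of_nonpos (k1_nonpos hx0)]
  calc -k1 x ≤ exp x / (exp x - 1) * k x := by
        unfold k1 k
        rw [← neg_div, div_mul_div_comm, ← pow_two]
        gcongr
        linarith
    _ ≤ _ := by
        have := k_le hx0
        have : 0 ≤ k x := by unfold k; positivity
        gcongr

lemma k_conv {a b : ℝ} (ha : 0 < a) (hab : a < b) :
    k1 a * (b - a) ≤ k b - k a ∧ k b - k a ≤ k1 b * (b - a) := by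
  obtain ⟨c, hc, h⟩ := exists_hasDerivAt_eq_slope k k1 hab
    (fun y hy => (hk (lt_of_lt_of_le ha hy.1)).continuousAt.continuousWithinAt)
    (fun y hy => hk (ha.trans hy.1))
  have hba : 0 < b - a := by linarith
  rw [eq_div_iff hba.ne'] at h
  rw [← h]
  have hc0 : 0 < c := ha.trans hc.1
  constructor
  · exact mul_le_mul_of_nonneg_right (k1_mono ha hc0 hc.1.le) hba.le
  · exact mul_le_mul_of_nonneg_right (k1_mono hc0 (ha.trans hab : (0:ℝ) < b) hc.2.le) hba.le

lemma geo {t : ℝ} (ht : 0 < t) : Summable (fun n : ℕ => exp (-(((n:ℝ) + 1) * t / 2))) := by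
  have : Summable (fun n : ℕ => exp (-(t/2)) * exp (-(t/2)) ^ n) := by
    apply Summable.mul_left
    apply summable_geometric_of_lt_one (exp_pos _).le
    rw [exp_lt_one_iff]; linarith
  convert this using 2 with n
  rw [← exp_nat_mul, ← exp_add]; congr 1; ring

lemma geo2 {t : ℝ} (ht : 0 < t) : Summable (fun n : ℕ => ((n:ℝ) + 1) * exp (-(((n:ℝ) + 1) * t / 2))) ∧
    ∑' n : ℕ, ((n:ℝ) + 1) * exp (-(((n:ℝ) + 1) * t / 2)) ≤ 4 / t ^ 2 := by
  set r := exp (-(t/2)) with hr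
  have hr0 : 0 < r := exp_pos _
  have hr1 : r < 1 := by rw [hr, exp_lt_one_iff]; linarith
  have H := hasSum_coe_mul_geometric_of_norm_lt_one (r := r) (by rwa [norm_of_nonneg hr0.le])
  have H' := (hasSum_nat_add_iff' 1).2 H
  simp only [Finset.range_one, Finset.sum_singleton, Nat.cast_zero, zero_mul, sub_zero] at H'
  have he : (fun n : ℕ => ((n:ℝ) + 1) * exp (-(((n:ℝ) + 1) * t / 2))) = fun n : ℕ => ((n+1 : ℕ):ℝ) * r ^ (n+1) := by
    funext n
    rw [hr, ← exp_nat_mul]; push_cast; congr 2; ring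
  rw [he]
  refine ⟨H'.summable, ?_⟩
  rw [H'.tsum_eq]
  have h1 : 0 < 1 - r := by linarith
  rw [div_le_div_iff₀ (by positivity) (by positivity)]
  have := key3 (x := t/2) (by linarith)
  have e : exp (t/2) * r = 1 := by rw [hr, ← exp_add]; simp
  have h2 := mul_le_mul_of_nonneg_right this (show 0 ≤ r ^ 2 by positivity)
  have h3 : (exp (t/2) - 1) ^ 2 * r ^ 2 = (1 - r) ^ 2 := by
    rw [← mul_pow, sub_mul, e]; ring
  have h4 : (t/2) ^ 2 * exp (t/2) * r ^ 2 = (t/2)^2 * r := by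
    calc _ = (t/2)^2 * r * (exp (t/2) * r) := by ring
      _ = _ := by rw [e, mul_one]
  rw [h3, h4] at h2
  linarith


lemma mono_tel (a : ℕ → ℝ) (l : ℝ) (hm : ∀ n, a n ≤ a (n+1)) (hl : Tendsto a atTop (𝓝 l)) :
    HasSum (fun n => a (n+1) - a n) (l - a 0) := by
  rw [hasSum_iff_tendsto_nat_of_nonneg (fun n => sub_nonneg.2 (hm n))]
  simp_rw [Finset.sum_range_sub]
  exact hl.sub_const _

/-- the terms -/
noncomputable def g (n : ℕ) (t : ℝ) : ℝ := t * (1 / (exp ((n + 1) * t) - 1))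

lemma F_eq : (fun s => s * DSum s) = fun s => ∑' n, g n s := by
  funext s
  simp only [DSum, g, tsum_mul_left]

lemma g_eq (n : ℕ) (t : ℝ) : g n t = k ((n+1) * t) / (n+1) := by
  have : (0:ℝ) < n + 1 := by positivity
  unfold g k
  field_simp

lemma npos (n : ℕ) : (0:ℝ) < n + 1 := by positivity

lemma g_sum {t : ℝ} (ht : 0 < t) : Summable (fun n => g n t) := by
  apply Summable.of_nonneg_of_le _ _ (geo ht)
  · intro n
    have := em1 (mul_pos (npos n) ht)
    unfold g; positivity
  · intro n
    rw [g_eq]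
    have h := k_le (mul_pos (npos n) ht)
    have h1 := em1 (mul_pos (npos n) ht)
    have h2 : 0 ≤ k ((n+1) * t) := by unfold k; have := npos n; positivity
    refine le_trans (div_le_self h2 ?_) h
    linarith [(Nat.cast_nonneg n : (0:ℝ) ≤ n)]

lemma hg (n : ℕ) {t : ℝ} (ht : 0 < t) : HasDerivAt (g n) (k1 ((n+1) * t)) t := by
  have h := hk (mul_pos (npos n) ht)
  have h2 : HasDerivAt (fun s : ℝ => ((n:ℝ)+1) * s) ((n:ℝ)+1) t := by
    simpa using (hasDerivAt_id t).const_mul ((n:ℝ)+1)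
  have h3 := (HasDerivAt.comp t h h2).div_const ((n:ℝ)+1)
  have e : g n = fun s => (k ∘ fun s : ℝ => ((n:ℝ)+1) * s) s / ((n:ℝ)+1) := by
    funext s; rw [g_eq]; rfl
  rw [e]
  convert! h3 using 1
  have := (npos n).ne'
  field_simp

lemma hgg (n : ℕ) {t : ℝ} (ht : 0 < t) :
    HasDerivAt (fun s : ℝ => k1 (((n:ℝ)+1) * s)) (((n:ℝ)+1) * k2 ((n+1) * t)) t := by
  have h := hk1 (mul_pos (npos n) ht)
  have h2 : HasDerivAt (fun s : ℝ => ((n:ℝ)+1) * s) ((n:ℝ)+1) t := by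
    simpa using (hasDerivAt_id t).const_mul ((n:ℝ)+1)
  have h3 := (HasDerivAt.comp t h h2)
  convert! h3 using 1
  ring

lemma k1_sum {a t : ℝ} (ha : 0 < a) (n : ℕ) (hat : a ≤ t) :
    ‖k1 (((n:ℝ)+1) * t)‖ ≤ (1 - exp (-a))⁻¹ * exp (-(((n:ℝ)+1) * a / 2)) := by
  have hn : (0:ℝ) ≤ n := Nat.cast_nonneg n
  have h1 : 0 < 1 - exp (-a) := by
    have : exp (-a) < 1 := by rw [exp_lt_one_iff]; linarith
    linarith
  rw [Real.norm_eq_abs]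
  refine (k1_bd ha (x := ((n:ℝ)+1) * t) (by nlinarith)).trans ?_
  gcongr

lemma k1_summable {t : ℝ} (ht : 0 < t) : Summable (fun n : ℕ => k1 (((n:ℝ)+1) * t)) :=
  Summable.of_norm_bounded ((geo ht).mul_left _) (fun n => k1_sum ht n le_rfl)

lemma hF {t : ℝ} (ht : 0 < t) :
    HasDerivAt (fun s => s * DSum s) (∑' n : ℕ, k1 (((n:ℝ)+1) * t)) t := by
  rw [F_eq]
  have ha : 0 < t/2 := by linarith
  exact hasDerivAt_tsum_of_isPreconnected (t := Set.Ioi (t/2)) (y₀ := t)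
    (u := fun n : ℕ => (1 - exp (-(t/2)))⁻¹ * exp (-(((n:ℝ)+1) * (t/2) / 2)))
    (g := g) (g' := fun n s => k1 (((n:ℝ)+1) * s))
    ((geo ha).mul_left _) isOpen_Ioi isPreconnected_Ioi
    (fun n y hy => hg n (ha.trans hy)) (fun n y hy => k1_sum ha n (le_of_lt hy))
    (Set.mem_Ioi.2 (by linarith)) (g_sum ht) (Set.mem_Ioi.2 (by linarith))

lemma k2_bd {a t : ℝ} (ha : 0 < a) (n : ℕ) (hat : a ≤ t) :
    ‖((n:ℝ)+1) * k2 (((n:ℝ)+1) * t)‖ ≤ 16 * (((n:ℝ)+1) * exp (-(((n:ℝ)+1) * a / 2))) := by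
  have hp := mul_pos (npos n) (ha.trans_le hat)
  rw [Real.norm_of_nonneg (mul_nonneg (npos n).le (k2_nonneg hp))]
  have := k2_le hp
  calc _ ≤ ((n:ℝ)+1) * (16 * exp (-(((n:ℝ)+1) * t / 2))) := by gcongr
    _ ≤ ((n:ℝ)+1) * (16 * exp (-(((n:ℝ)+1) * a / 2))) := by gcongr
    _ = _ := by ring

lemma hFF {t : ℝ} (ht : 0 < t) :
    HasDerivAt (deriv (fun s => s * DSum s)) (∑' n : ℕ, ((n:ℝ)+1) * k2 (((n:ℝ)+1) * t)) t := by
  have ha : 0 < t/2 := by linarith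
  have : HasDerivAt (fun s => ∑' n : ℕ, k1 (((n:ℝ)+1) * s)) (∑' n : ℕ, ((n:ℝ)+1) * k2 (((n:ℝ)+1) * t)) t :=
    hasDerivAt_tsum_of_isPreconnected (t := Set.Ioi (t/2)) (y₀ := t)
    (u := fun n : ℕ => 16 * (((n:ℝ)+1) * exp (-(((n:ℝ)+1) * (t/2) / 2))))
    (g := fun n s => k1 (((n:ℝ)+1) * s)) (g' := fun n s => ((n:ℝ)+1) * k2 (((n:ℝ)+1) * s))
    ((geo2 ha).1.mul_left _) isOpen_Ioi isPreconnected_Ioi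
    (fun n y hy => hgg n (ha.trans hy)) (fun n y hy => k2_bd ha n (le_of_lt hy))
    (Set.mem_Ioi.2 (by linarith)) (k1_summable ht) (Set.mem_Ioi.2 (by linarith))
  apply this.congr_of_eventuallyEq
  filter_upwards [Ioi_mem_nhds ht] with s hs
  exact (hF hs).deriv

lemma F2_bd {t : ℝ} (ht : 0 < t) : ‖deriv (deriv (fun s => s * DSum s)) t‖ ≤ 64 * (t^2)⁻¹ := by
  rw [(hFF ht).deriv]
  have h := tsum_of_norm_bounded (((geo2 ht).1.mul_left 16).hasSum) (fun n => k2_bd ht n le_rfl)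
  refine h.trans ?_
  rw [tsum_mul_left]
  have := (geo2 ht).2
  rw [div_eq_mul_inv] at this
  linarith

lemma F1_bd {t : ℝ} (ht : 0 < t) (ht1 : t < 1) :
    -t⁻¹ ≤ deriv (fun s => s * DSum s) t ∧ deriv (fun s => s * DSum s) t ≤ -t⁻¹ + 1 := by
  rw [(hF ht).deriv]
  have hs := k1_summable ht
  set S := ∑' n : ℕ, k1 (((n:ℝ)+1) * t) with hS
  have hstep : ∀ n : ℕ, k1 (((n:ℝ)+1) * t) * t ≤ k (((n:ℝ)+1+1) * t) - k (((n:ℝ)+1) * t) ∧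
      k (((n:ℝ)+1+1) * t) - k (((n:ℝ)+1) * t) ≤ k1 (((n:ℝ)+1+1) * t) * t := by
    intro n
    have := k_conv (a := ((n:ℝ)+1) * t) (b := ((n:ℝ)+1+1) * t) (mul_pos (npos n) ht) (by nlinarith)
    have e : ((n:ℝ)+1+1) * t - ((n:ℝ)+1) * t = t := by ring
    rwa [e] at this
  have hlim : Tendsto (fun n : ℕ => -k (((n:ℝ)+1) * t)) atTop (𝓝 0) := by
    have h0 := (geo ht).tendsto_atTop_zero
    have : Tendsto (fun n : ℕ => k (((n:ℝ)+1) * t)) atTop (𝓝 0) := by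
      refine squeeze_zero (fun n => ?_) (fun n => k_le (mul_pos (npos n) ht)) h0
      have := em1 (mul_pos (npos n) ht)
      have := npos n
      unfold k; positivity
    simpa using this.neg
  have tel := mono_tel (fun n : ℕ => -k (((n:ℝ)+1) * t)) 0 (fun n => by
    have := (hstep n).2
    have h2 := k1_nonpos (mul_pos (show 0 < (n:ℝ)+1+1 by linarith [npos n]) ht)
    push_cast
    nlinarith) hlim
  have tel2 : HasSum (fun n : ℕ => k (((n:ℝ)+1+1) * t) - k (((n:ℝ)+1) * t)) (-k t) := by
    convert! tel.neg using 1
    · funext n; push_cast; ring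
    · simp
  have up : S * t ≤ -k t := hasSum_le (fun n => (hstep n).1) (hs.hasSum.mul_right t) tel2
  have hS2 : HasSum (fun n : ℕ => k1 (((n:ℝ)+1+1) * t) * t) ((S - k1 t) * t) := by
    have := ((hasSum_nat_add_iff' 1).2 hs.hasSum).mul_right t
    simpa using this
  have lo : -k t ≤ (S - k1 t) * t := hasSum_le (fun n => (hstep n).2) tel2 hS2
  have hE := em1 ht
  have h1 : k t - k1 t * t ≤ 1 := by
    have : k t - k1 t * t = t^2 * exp t / (exp t - 1)^2 := by
      unfold k k1; field_simp; ring
    rw [this, div_le_one (by positivity)]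
    exact key3 ht.le
  have h2 : 1 - t ≤ k t := by
    unfold k
    rw [le_div_iff₀ hE]
    have h3 := Real.add_one_le_exp (-t)
    have h4 : exp t * exp (-t) = 1 := by rw [← exp_add]; simp
    nlinarith [exp_pos t]
  constructor
  · rw [neg_le_iff_add_nonneg, ← mul_le_mul_iff_of_pos_right ht]
    rw [add_mul, inv_mul_cancel₀ ht.ne']
    linarith
  · rw [← mul_le_mul_iff_of_pos_right ht, add_mul, neg_mul, inv_mul_cancel₀ ht.ne']
    linarith

/-! The limit. -/

noncomputable def f (x : ℝ) : ℝ := 1 / (exp x - 1)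
noncomputable def L (x : ℝ) : ℝ := log (1 - exp (-x))

lemma hL {x : ℝ} (hx : 0 < x) : HasDerivAt L (f x) x := by
  have h1 : 0 < 1 - exp (-x) := by
    have : exp (-x) < 1 := by rw [exp_lt_one_iff]; linarith
    linarith
  have h2 := ((hasDerivAt_id x).neg.exp.const_sub 1).log h1.ne'
  convert! h2 using 1
  have := em1 hx
  simp [f]
  rw [exp_neg] at h1 ⊢
  have hE := exp_pos x
  field_simp

lemma hf {x : ℝ} (hx : 0 < x) : HasDerivAt f (-exp x / (exp x - 1)^2) x := by
  have h := em1 hx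
  have := (hasDerivAt_const x (1:ℝ)).div ((Real.hasDerivAt_exp x).sub_const 1) h.ne'
  convert! this using 1
  simp

lemma f_anti {a b : ℝ} (ha : 0 < a) (hab : a ≤ b) : f b ≤ f a := by
  have := em1 ha
  unfold f; gcongr

lemma phi_mono : MonotoneOn (fun x => f x - x⁻¹) (Set.Ioi 0) := by
  have hd : ∀ x : ℝ, 0 < x → HasDerivAt (fun x => f x - x⁻¹) (-exp x / (exp x - 1)^2 - -(x^2)⁻¹) x :=
    fun x hx => (hf hx).sub (hasDerivAt_inv hx.ne')
  apply monotoneOn_of_deriv_nonneg (convex_Ioi 0)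
  · exact fun y hy => (hd y hy).continuousAt.continuousWithinAt
  · rw [interior_Ioi]; exact fun y hy => (hd y hy).differentiableAt.differentiableWithinAt
  · rw [interior_Ioi]; intro y hy
    rw [(hd y hy).deriv]
    have hy : 0 < y := hy
    have := em1 hy
    have : exp y / (exp y - 1)^2 ≤ (y^2)⁻¹ := by
      rw [div_le_iff₀ (by positivity), inv_mul_eq_div, le_div_iff₀ (by positivity)]
      linarith [key3 hy.le]
    rw [neg_div]; linarith

noncomputable def T (n : ℕ) (t : ℝ) : ℝ := g n t - (L (((n:ℝ)+1+1) * t) - L (((n:ℝ)+1) * t))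

lemma T_bd (n : ℕ) {t : ℝ} (ht : 0 < t) : ‖T n t‖ ≤ ((n:ℝ)+1)⁻¹ - ((n:ℝ)+1+1)⁻¹ := by
  set a := ((n:ℝ)+1) * t with ha
  set b := ((n:ℝ)+1+1) * t with hb
  have ha0 : 0 < a := mul_pos (npos n) ht
  have hba : b - a = t := by rw [ha, hb]; ring
  have hab : a < b := by linarith
  obtain ⟨c, hc, h⟩ := exists_hasDerivAt_eq_slope L f hab
    (fun y hy => (hL (lt_of_lt_of_le ha0 hy.1)).continuousAt.continuousWithinAt)
    (fun y hy => hL (ha0.trans hy.1))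
  rw [hba, eq_div_iff ht.ne'] at h
  have hT : T n t = t * (f a - f c) := by
    unfold T
    rw [← hb, ← ha, ← h]
    simp only [g, ← ha, f]; ring
  have h1 := f_anti ha0 hc.1.le
  have h2 := f_anti (ha0.trans hc.1) hc.2.le
  have h3 : f a - a⁻¹ ≤ f b - b⁻¹ := phi_mono ha0 (ha0.trans hab : (0:ℝ) < b) hab.le
  rw [hT, Real.norm_of_nonneg (mul_nonneg ht.le (by linarith))]
  calc t * (f a - f c) ≤ t * (a⁻¹ - b⁻¹) := mul_le_mul_of_nonneg_left (by linarith) ht.le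
    _ = _ := by
      rw [ha, hb]
      have := npos n
      field_simp

lemma bound_summable : Summable (fun n : ℕ => ((n:ℝ)+1)⁻¹ - ((n:ℝ)+1+1)⁻¹) := by
  have := mono_tel (fun n : ℕ => -((n:ℝ)+1)⁻¹) 0 (fun n => by
    push_cast
    have := npos n
    rw [neg_le_neg_iff]
    gcongr; linarith) (by
    have := (tendsto_one_div_add_atTop_nhds_zero_nat (𝕜 := ℝ)).neg
    simpa using this)
  convert! this.summable using 1
  funext n; push_cast; ring

lemma em_lim : Tendsto (fun t : ℝ => (1 - exp (-t)) / t) (𝓝[>] 0) (𝓝 1) := by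
  have h : HasDerivAt (fun t : ℝ => 1 - exp (-t)) 1 0 := by
    have := ((hasDerivAt_id (0:ℝ)).neg.exp.const_sub 1)
    convert! this using 1; simp
  have h2 := (hasDerivAt_iff_tendsto_slope.1 h).mono_left
    (nhdsWithin_mono 0 (fun x (hx : 0 < x) => (hx.ne' : x ≠ 0)))
  refine h2.congr (fun t => ?_)
  simp [slope_def_field]

lemma scale {c : ℝ} (hc : 0 < c) : Tendsto (fun t : ℝ => c * t) (𝓝[>] 0) (𝓝[>] 0) := by
  rw [tendsto_nhdsWithin_iff]
  constructor
  · have : Tendsto (fun t : ℝ => c * t) (𝓝 0) (𝓝 (c * 0)) := (continuous_const.mul continuous_id).tendsto 0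
    rw [mul_zero] at this
    exact this.mono_left nhdsWithin_le_nhds
  · filter_upwards [self_mem_nhdsWithin] with t ht
    exact mul_pos hc ht

/-- `L(ct) - log t → log c`. -/
lemma L_lim {c : ℝ} (hc : 0 < c) : Tendsto (fun t : ℝ => L (c * t) - log t) (𝓝[>] 0) (𝓝 (log c)) := by
  have h := ((em_lim.comp (scale hc)).log one_ne_zero).add_const (log c)
  rw [log_one, zero_add] at h
  refine h.congr' ?_
  filter_upwards [self_mem_nhdsWithin] with t (ht : 0 < t)
  have h0 : 0 < c * t := mul_pos hc ht
  have h1 : 0 < 1 - exp (-(c * t)) := by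
    have : exp (-(c * t)) < 1 := by rw [exp_lt_one_iff]; linarith
    linarith
  simp only [Function.comp, L]
  rw [log_div h1.ne' h0.ne', log_mul hc.ne' ht.ne']
  ring

lemma k_lim : Tendsto k (𝓝[>] 0) (𝓝 1) := by
  have h1 : Tendsto (fun t : ℝ => exp (-t)) (𝓝[>] 0) (𝓝 1) := by
    have : Tendsto (fun t : ℝ => exp (-t)) (𝓝 0) (𝓝 (exp (-0))) :=
      (continuous_exp.comp continuous_neg).tendsto 0
    simp only [neg_zero, exp_zero] at this
    exact this.mono_left nhdsWithin_le_nhds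
  have h := h1.div em_lim one_ne_zero
  rw [div_one] at h
  refine h.congr' ?_
  filter_upwards [self_mem_nhdsWithin] with t (ht : 0 < t)
  have := em1 ht
  have h1 : 0 < 1 - exp (-t) := by
    have : exp (-t) < 1 := by rw [exp_lt_one_iff]; linarith
    linarith
  simp only [k, Pi.div_apply]
  rw [exp_neg] at h1 ⊢
  have hE := exp_pos t
  field_simp

lemma T_lim (n : ℕ) : Tendsto (T n) (𝓝[>] 0)
    (𝓝 (((n:ℝ)+1)⁻¹ - (log ((n:ℝ)+1+1) - log ((n:ℝ)+1)))) := by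
  have h1 := (k_lim.comp (scale (npos n))).div_const ((n:ℝ)+1)
  have h2 := L_lim (npos n)
  have h3 := L_lim (show 0 < (n:ℝ)+1+1 by linarith [npos n])
  have h := h1.sub (h3.sub h2)
  rw [one_div] at h
  refine h.congr (fun t => ?_)
  simp only [T, g_eq, Function.comp]
  ring

lemma gamma_sum : HasSum (fun n : ℕ => ((n:ℝ)+1)⁻¹ - (log ((n:ℝ)+1+1) - log ((n:ℝ)+1)))
    eulerMascheroniConstant := by
  have := mono_tel eulerMascheroniSeq _ (fun n => (strictMono_eulerMascheroniSeq (Nat.lt_succ_self n)).le)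
    tendsto_eulerMascheroniSeq
  rw [eulerMascheroniSeq_zero, sub_zero] at this
  convert! this using 1
  funext n
  simp only [eulerMascheroniSeq, harmonic_succ]
  push_cast
  ring

lemma L_sum {t : ℝ} (ht : 0 < t) :
    HasSum (fun n : ℕ => L (((n:ℝ)+1+1) * t) - L (((n:ℝ)+1) * t)) (-L t) := by
  have hlim : Tendsto (fun n : ℕ => L (((n:ℝ)+1) * t)) atTop (𝓝 0) := by
    have h1 : Tendsto (fun n : ℕ => ((n:ℝ)+1) * t) atTop atTop :=
      (tendsto_atTop_add_const_right _ _ tendsto_natCast_atTop_atTop).atTop_mul_const ht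
    have h2 := (tendsto_exp_neg_atTop_nhds_zero.comp h1).const_sub 1
    rw [sub_zero] at h2
    have := h2.log one_ne_zero
    rw [log_one] at this
    exact this
  have := mono_tel (fun n : ℕ => L (((n:ℝ)+1) * t)) 0 (fun n => by
    have hp := mul_pos (npos n) ht
    unfold L
    have : exp (-(((n:ℝ)+1) * t)) < 1 := by rw [exp_lt_one_iff]; linarith
    push_cast
    apply log_le_log (by linarith)
    have : exp (-(((n:ℝ)+1+1) * t)) ≤ exp (-(((n:ℝ)+1) * t)) := by
      rw [exp_le_exp]; linarith
    linarith) hlim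
  convert! this using 1
  · funext n; push_cast; ring
  · simp

lemma F_lim : Tendsto (fun t => t * DSum t + log t) (𝓝[>] 0) (𝓝 eulerMascheroniConstant) := by
  have h := tendsto_tsum_of_dominated_convergence (𝓕 := 𝓝[>] (0:ℝ)) (f := fun t n => T n t)
    bound_summable T_lim (by
      filter_upwards [self_mem_nhdsWithin] with t ht n
      exact T_bd n ht)
  rw [gamma_sum.tsum_eq] at h
  have h2 := L_lim (zero_lt_one)
  have h3 := h.sub h2
  rw [log_one, sub_zero] at h3
  refine h3.congr' ?_
  filter_upwards [self_mem_nhdsWithin] with t (ht : 0 < t)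
  have e := ((g_sum ht).hasSum.sub (L_sum ht)).tsum_eq
  have e2 : ∑' n, T n t = ∑' n, g n t - -L t := e
  have e3 := congrFun F_eq t
  rw [e2, e3, one_mul]; ring

lemma F0_bd {t : ℝ} (ht : 0 < t) (ht1 : t < 1) :
    |t * DSum t - (eulerMascheroniConstant - log t)| ≤ t := by
  have hlip : ∀ s, 0 < s → s < t → |(t * DSum t + log t) - (s * DSum s + log s)| ≤ t := by
    intro s hs hst
    have hd : ∀ y, 0 < y → HasDerivAt (fun y => y * DSum y + log y) (deriv (fun s => s * DSum s) y + y⁻¹) y := by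
      intro y hy
      exact (hF hy).differentiableAt.hasDerivAt.add (Real.hasDerivAt_log hy.ne')
    obtain ⟨c, hc, h⟩ := exists_hasDerivAt_eq_slope _ _ hst
      (fun y hy => (hd y (lt_of_lt_of_le hs hy.1)).continuousAt.continuousWithinAt)
      (fun y hy => hd y (hs.trans hy.1))
    have hts : 0 < t - s := by linarith
    rw [eq_div_iff hts.ne'] at h
    rw [← h]
    have := F1_bd (hs.trans hc.1) (hc.2.trans ht1)
    rw [abs_le]
    constructor <;> nlinarith [this.1, this.2]
  have h1 : Tendsto (fun s => |(t * DSum t + log t) - (s * DSum s + log s)|) (𝓝[>] 0)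
      (𝓝 |(t * DSum t + log t) - eulerMascheroniConstant|) := (F_lim.const_sub _).abs
  have h2 := le_of_tendsto h1 (b := t) (by
    filter_upwards [Ioo_mem_nhdsGT ht] with s hs
    exact hlip s hs.1 hs.2)
  have e : t * DSum t - (eulerMascheroniConstant - log t)
      = (t * DSum t + log t) - eulerMascheroniConstant := by ring
  rw [e]; exact h2

end DS

theorem stmt14 :
    ((fun t : ℝ => t * DSum t - (Real.eulerMascheroniConstant - Real.log t))
        =O[𝓝[>] (0 : ℝ)] (fun t => Real.sqrt t)) ∧
    ((fun t : ℝ => deriv (fun s => s * DSum s) t - (-t⁻¹))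
        =O[𝓝[>] (0 : ℝ)] (fun t => (Real.sqrt t)⁻¹)) ∧
    ((fun t : ℝ => deriv (deriv (fun s => s * DSum s)) t)
        =O[𝓝[>] (0 : ℝ)] (fun t => (t ^ 2)⁻¹)) := by
  refine ⟨?_, ?_, ?_⟩
  · apply IsBigO.of_bound 1
    filter_upwards [Ioo_mem_nhdsGT (zero_lt_one (α := ℝ))] with t ht
    rw [Real.norm_eq_abs, Real.norm_of_nonneg (Real.sqrt_nonneg t), one_mul]
    refine (DS.F0_bd ht.1 ht.2).trans ?_
    apply Real.le_sqrt_of_sq_le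
    nlinarith [ht.1, ht.2]
  · apply IsBigO.of_bound 1
    filter_upwards [Ioo_mem_nhdsGT (zero_lt_one (α := ℝ))] with t ht
    rw [Real.norm_eq_abs, Real.norm_of_nonneg (inv_nonneg.2 (Real.sqrt_nonneg t)), one_mul]
    have h := DS.F1_bd ht.1 ht.2
    have h1 : 1 ≤ (Real.sqrt t)⁻¹ := by
      apply (one_le_inv₀ (Real.sqrt_pos.2 ht.1)).2
      exact Real.sqrt_le_one.2 ht.2.le
    rw [abs_le]
    constructor <;> linarith [h.1, h.2]
  · apply IsBigO.of_bound 64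
    filter_upwards [self_mem_nhdsWithin] with t (ht : 0 < t)
    rw [Real.norm_of_nonneg (show 0 ≤ (t^2)⁻¹ by positivity)]
    exact DS.F2_bd ht
end
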